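/- Let f ∈ ℚ[x_1,…,x_n] be a polynomial with rational coefficients that is non-negative and not identically zero on the standard n-simplex Δ_n = {x ∈ ℝ^n : x_i ≥ 0 for all i, x_1+⋯+x_n ≤ 1}. Define I(s) = ∫_{Δ_n} f(x)^s dμ(x) (Lebesgue measure) for Re(s) > 0. Then I extends to a meromorphic function on all of ℂ, and for every integer s_0, all coefficients a_i in the Laurent series expansion I(s) = Σ_{i ≥ N} a_i (s − s_0)^i of I at s_0 are periods. -/

import Mathlib

open MeasureTheory Complex

noncomputable section

/-- A subset of `ℝ^m` is *semi-arithmetic* if it is a finite union of finite intersections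
of sets of the form `{x | f x > 0}` or `{x | f x = 0}`, where the `f` are polynomials in
`m` variables with real algebraic coefficients. -/
def IsSemiArithmetic {m : ℕ} (C : Set (Fin m → ℝ)) : Prop :=
  ∃ (k : ℕ) (l : Fin k → ℕ) (p : (i : Fin k) → Fin (l i) → MvPolynomial (Fin m) ℝ)
    (b : (i : Fin k) → Fin (l i) → Bool),
    (∀ i j d, IsAlgebraic ℚ ((p i j).coeff d)) ∧
    C = ⋃ i, ⋂ j,
      (if b i j then {x | MvPolynomial.eval x (p i j) = 0}
       else {x | 0 < MvPolynomial.eval x (p i j)})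

/-- A real number is a (real) period if it is the value of an absolutely convergent Lebesgue
integral of a rational function with real algebraic coefficients over a semi-arithmetic set. -/
def IsRealPeriod (x : ℝ) : Prop :=
  ∃ (m : ℕ) (C : Set (Fin m → ℝ)) (p q : MvPolynomial (Fin m) ℝ),
    IsSemiArithmetic C ∧
    (∀ d, IsAlgebraic ℚ (p.coeff d)) ∧ (∀ d, IsAlgebraic ℚ (q.coeff d)) ∧
    IntegrableOn (fun y => MvPolynomial.eval y p / MvPolynomial.eval y q) C volume ∧
    x = ∫ y in C, MvPolynomial.eval y p / MvPolynomial.eval y q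

/-- A complex number is a period if its real and imaginary parts are periods. -/
def IsPeriod (z : ℂ) : Prop := IsRealPeriod z.re ∧ IsRealPeriod z.im



section Weyl
open MvPolynomial
variable {K V : Type*} [Field K] [AddCommGroup V] [Module K V] {n : ℕ}

lemma exists_algHom_of_commute (x : Fin n → Module.End K V) (h : ∀ i j, x i * x j = x j * x i) :
    ∃ φ : MvPolynomial (Fin n) K →ₐ[K] Module.End K V, ∀ i, φ (X i) = x i := by
  have hc : ∀ a ∈ Set.range x, ∀ b ∈ Set.range x, a * b = b * a := by
    rintro _ ⟨i, rfl⟩ _ ⟨j, rfl⟩; exact h i j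
  let : CommRing (Algebra.adjoin K (Set.range x)) :=
    { (inferInstance : Ring (Algebra.adjoin K (Set.range x))) with
      mul_comm := (Algebra.isMulCommutative_adjoin K hc).is_comm.comm }
  refine ⟨(Algebra.adjoin K (Set.range x)).val.comp
    (aeval (fun i => (⟨x i, Algebra.subset_adjoin ⟨i, rfl⟩⟩ : Algebra.adjoin K (Set.range x)))), ?_⟩
  intro i
  simp

lemma weyl_comm (φ : MvPolynomial (Fin n) K →ₐ[K] Module.End K V) (i : Fin n)
    (D : Module.End K V)
    (h : ∀ j, D * φ (X j) = φ (X j) * D + (if j = i then 1 else 0))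
    (g : MvPolynomial (Fin n) K) :
    D * φ g = φ g * D + φ (pderiv i g) := by
  induction g using MvPolynomial.induction_on with
  | C a =>
    have : φ (C a) = algebraMap K _ a := φ.commutes a
    rw [this, pderiv_C, map_zero, add_zero, Algebra.commutes]
  | add p q hp hq => simp only [map_add, mul_add, add_mul, hp, hq]; abel
  | mul_X p j hp =>
    rw [map_mul, ← mul_assoc, hp, add_mul, mul_assoc, h j, mul_add, pderiv_mul, map_add, map_mul,
      map_mul, pderiv_X]
    by_cases hj : j = i
    · subst hj; simp [mul_assoc]; abel
    · simp [hj, mul_assoc]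

lemma eq_C_of_pderiv_eq_zero [CharZero K] {σ : Type*} (p : MvPolynomial σ K) (h : ∀ i, pderiv i p = 0) :
    p = C (coeff 0 p) := by
  classical
  ext m
  rw [coeff_C]
  split_ifs with hm
  · rw [← hm]
  · obtain ⟨i, hi⟩ : ∃ i, m i ≠ 0 := by
      by_contra! hh; exact hm (Finsupp.ext fun i => (hh i).symm)
    have := congrArg (coeff (m - Finsupp.single i 1)) (h i)
    rw [coeff_pderiv, coeff_zero, tsub_add_cancel_of_le
      (Finsupp.single_le_iff.2 (Nat.one_le_iff_ne_zero.2 hi))] at this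
    rcases mul_eq_zero.1 this with h1 | h1
    · exact h1
    · exfalso; norm_cast at h1

lemma totalDegree_pderiv_le' {σ : Type*} (p : MvPolynomial σ K) (i : σ) (N : ℕ)
    (h : p.totalDegree ≤ N + 1) : (pderiv i p).totalDegree ≤ N := by
  refine Finset.sup_le fun m hm => ?_
  rw [mem_support_iff, coeff_pderiv] at hm
  have h1 : m + Finsupp.single i 1 ∈ p.support := mem_support_iff.2 (left_ne_zero_of_mul hm)
  have h2 := (le_totalDegree h1).trans h
  rw [Finsupp.sum_add_index' (fun _ => rfl) (fun _ _ _ => rfl), Finsupp.sum_single_index rfl] at h2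
  omega

/-- action of formal symbols -/
def weylT (ρ δ : MvPolynomial (Fin n) K →ₐ[K] Module.End K V) :
    MvPolynomial (Fin n ⊕ Fin n) K →ₗ[K] Module.End K V :=
  (basisMonomials (Fin n ⊕ Fin n) K).constr K (fun γ =>
    ρ (monomial (γ.comapDomain Sum.inl Sum.inl_injective.injOn) 1) *
    δ (monomial (γ.comapDomain Sum.inr Sum.inr_injective.injOn) 1))

lemma weylT_monomial (ρ δ : MvPolynomial (Fin n) K →ₐ[K] Module.End K V)
    (γ : Fin n ⊕ Fin n →₀ ℕ) (c : K) :
    weylT ρ δ (monomial γ c) = c • (ρ (monomial (γ.comapDomain Sum.inl Sum.inl_injective.injOn) 1) *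
    δ (monomial (γ.comapDomain Sum.inr Sum.inr_injective.injOn) 1)) := by
  have : monomial γ c = c • basisMonomials (Fin n ⊕ Fin n) K γ := by
    simp [coe_basisMonomials, smul_monomial]
  rw [this, map_smul, weylT, Module.Basis.constr_basis]

lemma weylT_one (ρ δ : MvPolynomial (Fin n) K →ₐ[K] Module.End K V) (c : K) :
    weylT ρ δ (C c) = c • 1 := by
  rw [C_apply, weylT_monomial]
  have h1 : Finsupp.comapDomain (Sum.inl : Fin n → Fin n ⊕ Fin n) (0 : Fin n ⊕ Fin n →₀ ℕ)
    Sum.inl_injective.injOn = 0 := by ext; simp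
  have h2 : Finsupp.comapDomain (Sum.inr : Fin n → Fin n ⊕ Fin n) (0 : Fin n ⊕ Fin n →₀ ℕ)
    Sum.inr_injective.injOn = 0 := by ext; simp
  rw [h1, h2]
  have : monomial (0 : Fin n →₀ ℕ) (1 : K) = 1 := rfl
  rw [this]; simp

lemma weylT_pderiv_inl (ρ δ : MvPolynomial (Fin n) K →ₐ[K] Module.End K V)
    (h : ∀ i j, δ (X i) * ρ (X j) = ρ (X j) * δ (X i) + (if j = i then 1 else 0))
    (i : Fin n) (p : MvPolynomial (Fin n ⊕ Fin n) K) :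
    δ (X i) * weylT ρ δ p = weylT ρ δ p * δ (X i) + weylT ρ δ (pderiv (Sum.inl i) p) := by
  induction p using MvPolynomial.induction_on' with
  | add p q hp hq => simp only [map_add, mul_add, add_mul, hp, hq]; abel
  | monomial γ c =>
    rw [pderiv_monomial, weylT_monomial, weylT_monomial]
    have h1 : Finsupp.comapDomain (Sum.inl : Fin n → Fin n ⊕ Fin n) (γ - Finsupp.single (Sum.inl i) 1)
      Sum.inl_injective.injOn = γ.comapDomain Sum.inl Sum.inl_injective.injOn - Finsupp.single i 1 := by
      ext j; simp [Finsupp.single_apply]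
    have h2 : Finsupp.comapDomain (Sum.inr : Fin n → Fin n ⊕ Fin n) (γ - Finsupp.single (Sum.inl i) 1)
      Sum.inr_injective.injOn = γ.comapDomain Sum.inr Sum.inr_injective.injOn := by
      ext j; simp
    rw [h1, h2, mul_smul_comm, ← mul_assoc, weyl_comm ρ i _ (h i), pderiv_monomial]
    have h3 : ∀ α : Fin n →₀ ℕ, ∀ k : ℕ, monomial α ((1 : K) * k) = (k : K) • monomial α (1:K) := by
      intro α k; rw [smul_monomial]; simp
    rw [h3, map_smul, Finsupp.comapDomain_apply, add_mul, smul_add, smul_mul_assoc, mul_assoc,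
      mul_smul, smul_mul_assoc, mul_assoc, ← map_mul, ← map_mul, mul_comm (X i)]

lemma weylT_pderiv_inr (ρ δ : MvPolynomial (Fin n) K →ₐ[K] Module.End K V)
    (h : ∀ i j, δ (X i) * ρ (X j) = ρ (X j) * δ (X i) + (if j = i then 1 else 0))
    (i : Fin n) (p : MvPolynomial (Fin n ⊕ Fin n) K) :
    weylT ρ δ p * ρ (X i) = ρ (X i) * weylT ρ δ p + weylT ρ δ (pderiv (Sum.inr i) p) := by
  have key : ∀ g, - ρ (X i) * δ g = δ g * (- ρ (X i)) + δ (pderiv i g) := by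
    apply weyl_comm
    intro j
    have := h j i
    rw [mul_neg, this]; by_cases hj : i = j
    · subst hj; simp
    · simp [hj, Ne.symm hj]
  have key' : ∀ g, δ g * ρ (X i) = ρ (X i) * δ g + δ (pderiv i g) := by
    intro g
    have := key g
    rw [neg_mul, mul_neg, neg_eq_iff_eq_neg] at this
    rw [this]; simp
  induction p using MvPolynomial.induction_on' with
  | add p q hp hq => simp only [map_add, mul_add, add_mul, hp, hq]; abel
  | monomial γ c =>
    rw [pderiv_monomial, weylT_monomial, weylT_monomial]
    have h1 : Finsupp.comapDomain (Sum.inr : Fin n → Fin n ⊕ Fin n) (γ - Finsupp.single (Sum.inr i) 1)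
      Sum.inr_injective.injOn = γ.comapDomain Sum.inr Sum.inr_injective.injOn - Finsupp.single i 1 := by
      ext j; simp [Finsupp.single_apply]
    have h2 : Finsupp.comapDomain (Sum.inl : Fin n → Fin n ⊕ Fin n) (γ - Finsupp.single (Sum.inr i) 1)
      Sum.inl_injective.injOn = γ.comapDomain Sum.inl Sum.inl_injective.injOn := by
      ext j; simp
    have h3 : ∀ α : Fin n →₀ ℕ, ∀ k : ℕ, monomial α ((1 : K) * k) = (k : K) • monomial α (1:K) := by
      intro α k; rw [smul_monomial]; simp
    rw [h1, h2, smul_mul_assoc, mul_assoc, key', pderiv_monomial, h3, map_smul,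
      Finsupp.comapDomain_apply, mul_add, smul_add, mul_smul_comm, mul_smul_comm,
      mul_smul, ← mul_assoc, ← mul_assoc, ← map_mul, ← map_mul, mul_comm (X i)]

lemma weylT_maps (ρ δ : MvPolynomial (Fin n) K →ₐ[K] Module.End K V)
    (Φ : ℕ → Submodule K V) (hmono : Monotone Φ)
    (hx : ∀ i j, ∀ v ∈ Φ j, ρ (X i) v ∈ Φ (j + 1))
    (hD : ∀ i j, ∀ v ∈ Φ j, δ (X i) v ∈ Φ (j + 1))
    (N : ℕ) (p : MvPolynomial (Fin n ⊕ Fin n) K) (hp : p.totalDegree ≤ N) (j : ℕ) (v : V)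
    (hv : v ∈ Φ j) : weylT ρ δ p v ∈ Φ (j + N) := by
  have gen : ∀ (φ : MvPolynomial (Fin n) K →ₐ[K] Module.End K V),
      (∀ i j, ∀ v ∈ Φ j, φ (X i) v ∈ Φ (j + 1)) → ∀ (α : Fin n →₀ ℕ) (j : ℕ), ∀ v ∈ Φ j,
      φ (monomial α 1) v ∈ Φ (j + α.degree) := by
    intro φ hφ α
    induction α using Finsupp.induction_linear with
    | zero =>
      intro j v hv
      have : monomial (0 : Fin n →₀ ℕ) (1 : K) = 1 := rfl
      simpa [this] using hv
    | add a b ha hb =>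
      intro j v hv
      have : monomial (a + b) (1 : K) = monomial a 1 * monomial b 1 := by simp [monomial_mul]
      rw [this, map_mul, map_add]
      have := ha _ _ (hb j v hv)
      rwa [add_assoc, add_comm b.degree] at this
    | single i k =>
      intro j v hv
      rw [← X_pow_eq_monomial, map_pow, Finsupp.degree_single]
      induction k with
      | zero => simpa using hv
      | succ k ih => rw [pow_succ']; exact hφ i _ _ ih
  rw [← support_sum_monomial_coeff p, map_sum, LinearMap.sum_apply]
  refine Submodule.sum_mem _ fun γ hγ => ?_
  rw [weylT_monomial]
  refine Submodule.smul_mem _ _ ?_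
  have := gen ρ hx (γ.comapDomain Sum.inl Sum.inl_injective.injOn) _ _
    (gen δ hD (γ.comapDomain Sum.inr Sum.inr_injective.injOn) j v hv)
  refine hmono ?_ this
  have h2 := (le_totalDegree hγ).trans hp
  rw [Finsupp.sum_fintype _ _ (fun _ => rfl), Fintype.sum_sum_type] at h2
  simp only [Finsupp.degree_eq_sum, Finsupp.comapDomain_apply]
  omega

lemma weylT_faithful [CharZero K] (ρ δ : MvPolynomial (Fin n) K →ₐ[K] Module.End K V)
    (h : ∀ i j, δ (X i) * ρ (X j) = ρ (X j) * δ (X i) + (if j = i then 1 else 0))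
    (Φ : ℕ → Submodule K V) (hmono : Monotone Φ)
    (hx : ∀ i j, ∀ v ∈ Φ j, ρ (X i) v ∈ Φ (j + 1))
    (hD : ∀ i j, ∀ v ∈ Φ j, δ (X i) v ∈ Φ (j + 1))
    (a : ℕ) (v₀ : V) (hv₀ : v₀ ∈ Φ a) (hv₀' : v₀ ≠ 0)
    (N : ℕ) (p : MvPolynomial (Fin n ⊕ Fin n) K) (hp : p.totalDegree ≤ N)
    (hk : ∀ v ∈ Φ (a + N), weylT ρ δ p v = 0) : p = 0 := by
  have fin : (∀ i, pderiv i p = 0) → p = 0 := by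
    intro h0
    have hC := eq_C_of_pderiv_eq_zero p h0
    have h1 := hk v₀ (hmono (Nat.le_add_right a N) hv₀)
    rw [hC, weylT_one] at h1
    have h2 : coeff 0 p • v₀ = 0 := h1
    rcases smul_eq_zero.1 h2 with h3 | h3
    · rw [hC, h3, C_0]
    · exact absurd h3 hv₀'
  induction N generalizing p with
  | zero =>
    apply fin
    intro i
    rw [totalDegree_eq_zero_iff_eq_C.1 (Nat.le_zero.1 hp), pderiv_C]
  | succ N ih =>
    apply fin
    have aux : ∀ i, (∀ v ∈ Φ (a + N), weylT ρ δ (pderiv i p) v = 0) := by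
      rintro (i | i) v hv
      · have := LinearMap.congr_fun (weylT_pderiv_inl ρ δ h i p) v
        simp only [Module.End.mul_apply, LinearMap.add_apply] at this
        rw [hk v (hmono (by omega) hv), hk _ (hD i _ v hv)] at this
        simpa using this.symm
      · have := LinearMap.congr_fun (weylT_pderiv_inr ρ δ h i p) v
        simp only [Module.End.mul_apply, LinearMap.add_apply] at this
        rw [hk v (hmono (by omega) hv), hk _ (hx i _ v hv)] at this
        simpa using this.symm
    intro i
    refine ih _ (totalDegree_pderiv_le' p i N hp) (aux i) ?_
    intro h0
    have hC := eq_C_of_pderiv_eq_zero _ h0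
    have h1 := aux i v₀ (hmono (Nat.le_add_right a N) hv₀)
    rw [hC, weylT_one] at h1
    have h2 : coeff 0 (pderiv i p) • v₀ = 0 := h1
    rcases smul_eq_zero.1 h2 with h3 | h3
    · rw [hC, h3, C_0]
    · exact absurd h3 hv₀'

/-- Bernstein inequality -/
lemma bernstein_ineq [CharZero K] (x D : Fin n → Module.End K V)
    (hxx : ∀ i j, x i * x j = x j * x i) (hDD : ∀ i j, D i * D j = D j * D i)
    (h : ∀ i j, D i * x j = x j * D i + (if j = i then 1 else 0))
    (Φ : ℕ → Submodule K V) (hmono : Monotone Φ) (hfin : ∀ j, FiniteDimensional K (Φ j))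
    (hx : ∀ i j, ∀ v ∈ Φ j, x i v ∈ Φ (j + 1))
    (hD : ∀ i j, ∀ v ∈ Φ j, D i v ∈ Φ (j + 1))
    (a : ℕ) (ha : Φ a ≠ ⊥) (t : ℕ) :
    (t + 1) ^ (2 * n) ≤
      Module.finrank K (Φ (a + 2 * n * t)) * Module.finrank K (Φ (a + 4 * n * t)) := by
  obtain ⟨ρ, hρ⟩ := exists_algHom_of_commute x hxx
  obtain ⟨δ, hδ⟩ := exists_algHom_of_commute D hDD
  simp only [← hρ, ← hδ] at hx hD h
  obtain ⟨v₀, hv₀, hv₀'⟩ := (Submodule.ne_bot_iff _).1 ha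
  set N := 2 * n * t with hN
  let e : (Fin n ⊕ Fin n → Fin (t + 1)) → (Fin n ⊕ Fin n →₀ ℕ) := fun c =>
    Finsupp.equivFunOnFinite.symm (fun i => (c i : ℕ))
  have he : Function.Injective e := by
    intro c c' hc
    funext i
    have := DFunLike.congr_fun hc i
    exact Fin.ext (by simpa [e] using this)
  let P : ((Fin n ⊕ Fin n → Fin (t + 1)) → K) →ₗ[K] MvPolynomial (Fin n ⊕ Fin n) K :=
    Fintype.linearCombination K (fun c => monomial (e c) (1 : K))
  have hP : ∀ c, P c = ∑ i, c i • monomial (e i) (1 : K) := fun c =>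
    Fintype.linearCombination_apply _ _ _
  have hPdeg : ∀ c, (P c).totalDegree ≤ N := by
    intro c
    rw [hP]
    refine (totalDegree_finsetSum _ _).trans (Finset.sup_le fun i _ => ?_)
    refine (totalDegree_smul_le _ _).trans ((totalDegree_monomial_le _ _).trans ?_)
    rw [Finsupp.sum_fintype _ _ (fun _ => rfl)]
    calc ∑ k, e i k ≤ ∑ k : Fin n ⊕ Fin n, t :=
          Finset.sum_le_sum fun k _ => by simp [e]; exact Nat.lt_succ_iff.1 (i k).2
      _ = N := by
          simp only [Finset.sum_const, Finset.card_univ, Fintype.card_sum, Fintype.card_fin,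
            smul_eq_mul, hN]
          ring
  have hPinj : ∀ c, P c = 0 → c = 0 := by
    intro c hc
    funext k
    have := congrArg (coeff (e k)) hc
    rw [hP, coeff_sum] at this
    simpa [coeff_monomial, he.eq_iff] using this
  have hmaps : ∀ c, ∀ v ∈ Φ (a + N), weylT ρ δ (P c) v ∈ Φ (a + 4 * n * t) := by
    intro c v hv
    have := weylT_maps ρ δ Φ hmono hx hD N (P c) (hPdeg c) _ v hv
    refine hmono ?_ this
    rw [hN]; linarith
  let S : ((Fin n ⊕ Fin n → Fin (t + 1)) → K) →ₗ[K] (Φ (a + N) →ₗ[K] Φ (a + 4 * n * t)) :=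
    { toFun := fun c => (weylT ρ δ (P c)).restrict (hmaps c)
      map_add' := by intro c c'; ext v; simp [LinearMap.restrict_apply]
      map_smul' := by intro c c'; ext v; simp [LinearMap.restrict_apply] }
  have hS : Function.Injective S := by
    rw [← LinearMap.ker_eq_bot, LinearMap.ker_eq_bot']
    intro c hc
    apply hPinj
    refine weylT_faithful ρ δ h Φ hmono hx hD a v₀ hv₀ hv₀' N (P c) (hPdeg c) ?_
    intro v hv
    have := congrArg Subtype.val (LinearMap.congr_fun hc ⟨v, hv⟩)
    simpa [S, LinearMap.restrict_apply] using this
  have := LinearMap.finrank_le_finrank_of_injective hS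
  rw [Module.finrank_linearMap, Module.finrank_fintype_fun_eq_card] at this
  simpa [two_mul] using this

end Weyl


section Chain
variable {K V : Type*} [Field K] [AddCommGroup V] [Module K V] {n : ℕ}

lemma finrank_quot_aux (Φ N N' : Submodule K V) [FiniteDimensional K Φ] (hN : N' ≤ N) :
    Module.finrank K (Submodule.map N'.mkQ (Φ ⊓ N)) + Module.finrank K (Φ ⊓ N' : Submodule K V)
      = Module.finrank K (Φ ⊓ N : Submodule K V) := by
  have hfd : FiniteDimensional K (Φ ⊓ N : Submodule K V) := Submodule.finiteDimensional_inf_left _ _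
  have := LinearMap.finrank_range_add_finrank_ker (N'.mkQ.domRestrict (Φ ⊓ N))
  rw [LinearMap.range_domRestrict] at this
  rw [← this]
  congr 1
  have hle : Φ ⊓ N' ≤ Φ ⊓ N := inf_le_inf_left _ hN
  rw [← (Submodule.submoduleOfEquivOfLe hle).finrank_eq]
  have : Submodule.submoduleOf (Φ ⊓ N') (Φ ⊓ N) = LinearMap.ker (N'.mkQ.domRestrict (Φ ⊓ N)) := by
    ext ⟨v, hv⟩
    simp only [Submodule.submoduleOf, Submodule.mem_comap, Submodule.subtype_apply,
      Submodule.mem_inf, LinearMap.mem_ker, LinearMap.domRestrict_apply, Submodule.mkQ_apply,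
      Submodule.Quotient.mk_eq_zero]
    exact ⟨fun h => h.2, fun h => ⟨hv.1, h⟩⟩
  rw [this]

lemma bernstein_sub [CharZero K] (x D : Fin n → Module.End K V)
    (hxx : ∀ i j, x i * x j = x j * x i) (hDD : ∀ i j, D i * D j = D j * D i)
    (h : ∀ i j, D i * x j = x j * D i + (if j = i then 1 else 0))
    (Φ : ℕ → Submodule K V) (hmono : Monotone Φ) (hfin : ∀ j, FiniteDimensional K (Φ j))
    (hx : ∀ i j, ∀ v ∈ Φ j, x i v ∈ Φ (j + 1))
    (hD : ∀ i j, ∀ v ∈ Φ j, D i v ∈ Φ (j + 1))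
    (N N' : Submodule K V)
    (hNx : ∀ i, ∀ v ∈ N, x i v ∈ N) (hND : ∀ i, ∀ v ∈ N, D i v ∈ N)
    (hNx' : ∀ i, ∀ v ∈ N', x i v ∈ N') (hND' : ∀ i, ∀ v ∈ N', D i v ∈ N')
    (a : ℕ) (v₀ : V) (h1 : v₀ ∈ Φ a) (h2 : v₀ ∈ N) (h3 : v₀ ∉ N') (t : ℕ) :
    (t + 1) ^ (2 * n) ≤
      Module.finrank K (Submodule.map N'.mkQ (Φ (a + 2 * n * t) ⊓ N)) *
      Module.finrank K (Submodule.map N'.mkQ (Φ (a + 4 * n * t) ⊓ N)) := by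
  have hfd : ∀ j, FiniteDimensional K (Φ j ⊓ N : Submodule K V) :=
    fun j => Submodule.finiteDimensional_inf_left _ _
  refine bernstein_ineq (V := V ⧸ N') (fun i => N'.mapQ N' (x i) (fun v hv => hNx' i v hv))
    (fun i => N'.mapQ N' (D i) (fun v hv => hND' i v hv)) ?_ ?_ ?_
    (fun j => Submodule.map N'.mkQ (Φ j ⊓ N)) ?_ ?_ ?_ ?_ a ?_ t
  · intro i j
    apply Submodule.linearMap_qext
    ext v
    have := LinearMap.congr_fun (hxx i j) v
    simp only [Module.End.mul_apply] at this
    simp [this]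
  · intro i j
    apply Submodule.linearMap_qext
    ext v
    have := LinearMap.congr_fun (hDD i j) v
    simp only [Module.End.mul_apply] at this
    simp [this]
  · intro i j
    apply Submodule.linearMap_qext
    ext v
    have := LinearMap.congr_fun (h i j) v
    simp only [Module.End.mul_apply, LinearMap.add_apply] at this
    simp only [LinearMap.comp_apply, Module.End.mul_apply, Submodule.mkQ_apply,
      Submodule.mapQ_apply, this, LinearMap.add_apply, Submodule.Quotient.mk_add]
    split_ifs <;> simp
  · intro j k hjk
    exact Submodule.map_mono (inf_le_inf_right _ (hmono hjk))
  · intro j; infer_instance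
  · rintro i j _ ⟨v, ⟨hv, hv'⟩, rfl⟩
    exact ⟨x i v, ⟨hx i j v hv, hNx i v hv'⟩, by simp⟩
  · rintro i j _ ⟨v, ⟨hv, hv'⟩, rfl⟩
    exact ⟨D i v, ⟨hD i j v hv, hND i v hv'⟩, by simp⟩
  · rw [Submodule.ne_bot_iff]
    exact ⟨N'.mkQ v₀, ⟨v₀, ⟨h1, h2⟩, rfl⟩, by simpa using h3⟩

lemma bernstein_chain [CharZero K] (x D : Fin n → Module.End K V)
    (hxx : ∀ i j, x i * x j = x j * x i) (hDD : ∀ i j, D i * D j = D j * D i)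
    (h : ∀ i j, D i * x j = x j * D i + (if j = i then 1 else 0))
    (Φ : ℕ → Submodule K V) (hmono : Monotone Φ) (hfin : ∀ j, FiniteDimensional K (Φ j))
    (hx : ∀ i j, ∀ v ∈ Φ j, x i v ∈ Φ (j + 1))
    (hD : ∀ i j, ∀ v ∈ Φ j, D i v ∈ Φ (j + 1))
    (c : ℕ) (hc : ∀ j, Module.finrank K (Φ j) ≤ (c * (j + 1)) ^ n)
    (N : ℕ → Submodule K V) (hanti : ∀ m, N (m + 1) ≤ N m)
    (hNx : ∀ m i, ∀ v ∈ N m, x i v ∈ N m) (hND : ∀ m i, ∀ v ∈ N m, D i v ∈ N m)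
    (hNΦ : ∀ m, ∀ v ∈ N m, ∃ j, v ∈ Φ j) : ∃ m, N m ≤ N (m + 1) := by
  by_contra! hcon
  have hv : ∀ m, ∃ v ∈ N m, v ∉ N (m + 1) := fun m => Set.not_subset.1 (hcon m)
  choose v hv1 hv2 using hv
  have ha : ∀ m, ∃ j, v m ∈ Φ j := fun m => hNΦ m _ (hv1 m)
  choose a ha using ha
  set b := c * (4 * n + 1) with hb
  set r := b ^ (2 * n) + 1 with hr
  set A := (Finset.range r).sup a with hA
  have hA' : ∀ i ∈ Finset.range r, v i ∈ Φ A := fun i hi => hmono (Finset.le_sup hi) (ha i)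
  set J := A + 2 * n * A with hJ
  let H : ℕ → ℕ → ℕ := fun i j => Module.finrank K (Submodule.map (N (i+1)).mkQ (Φ j ⊓ N i))
  have hH : ∀ i j, H i j + Module.finrank K (Φ j ⊓ N (i+1) : Submodule K V)
      = Module.finrank K (Φ j ⊓ N i : Submodule K V) := fun i j =>
    finrank_quot_aux (Φ j) (N i) (N (i+1)) (hanti i)
  have hfr : ∀ i j, Module.finrank K (Φ j ⊓ N i : Submodule K V) ≤ (c * (j + 1)) ^ n :=
    fun i j => (Submodule.finrank_mono inf_le_left).trans (hc j)
  have hup : ∀ j, j ≤ A + 4 * n * A → c * (j + 1) ≤ b * (A + 1) := by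
    intro j hj
    rw [hb, mul_assoc]
    refine Nat.mul_le_mul_left _ ?_
    nlinarith
  have hlow : ∀ i ∈ Finset.range r, (A + 1) ^ n ≤ H i J * b ^ n := by
    intro i hi
    have h0 := bernstein_sub x D hxx hDD h Φ hmono hfin hx hD (N i) (N (i+1)) (hNx i) (hND i)
      (hNx _) (hND _) A (v i) (hA' i hi) (hv1 i) (hv2 i) A
    have h1 : H i (A + 4 * n * A) ≤ (b * (A + 1)) ^ n := by
      have := hH i (A + 4 * n * A)
      have h2 := hfr i (A + 4 * n * A)
      have h3 := Nat.pow_le_pow_left (hup _ le_rfl) n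
      omega
    have h4 : (A + 1) ^ n * (A + 1) ^ n ≤ (H i J * b ^ n) * (A + 1) ^ n := by
      calc (A + 1) ^ n * (A + 1) ^ n = (A + 1) ^ (2 * n) := by rw [two_mul, pow_add]
        _ ≤ H i J * H i (A + 4 * n * A) := h0
        _ ≤ H i J * (b * (A + 1)) ^ n := Nat.mul_le_mul_left _ h1
        _ = _ := by rw [mul_pow, mul_assoc]
    exact Nat.le_of_mul_le_mul_right h4 (by positivity)
  have hsum : ∀ k, ∑ i ∈ Finset.range k, H i J + Module.finrank K (Φ J ⊓ N k : Submodule K V)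
      = Module.finrank K (Φ J ⊓ N 0 : Submodule K V) := by
    intro k
    induction k with
    | zero => simp
    | succ k ih => rw [Finset.sum_range_succ, ← ih, ← hH k J]; ring
  have htot : ∑ i ∈ Finset.range r, H i J ≤ (b * (A + 1)) ^ n := by
    have h1 := hsum r
    have h2 := hfr 0 J
    have h3 := Nat.pow_le_pow_left (hup J (by rw [hJ]; nlinarith)) n
    omega
  have h5 : r * (A + 1) ^ n ≤ b ^ (2 * n) * (A + 1) ^ n := by
    calc r * (A + 1) ^ n = ∑ i ∈ Finset.range r, (A + 1) ^ n := by simp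
      _ ≤ ∑ i ∈ Finset.range r, H i J * b ^ n := Finset.sum_le_sum hlow
      _ = (∑ i ∈ Finset.range r, H i J) * b ^ n := by rw [Finset.sum_mul]
      _ ≤ (b * (A + 1)) ^ n * b ^ n := Nat.mul_le_mul_right _ htot
      _ = _ := by rw [mul_pow, two_mul, pow_add]; ring
  have := Nat.le_of_mul_le_mul_right h5 (by positivity)
  omega

end Chain


section Conn
open MvPolynomial
variable {K A : Type*} [Field K] [CommRing A] [Algebra K A] {n : ℕ}

/-- the twisted derivation -/
def nab (ι : MvPolynomial (Fin n) K →ₐ[K] A) (d : Fin n → Derivation K A A)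
    (F : MvPolynomial (Fin n) K) (u : A) (s : K) (i : Fin n) : Module.End K A :=
  (d i : A →ₗ[K] A) + s • LinearMap.mulLeft K (ι (pderiv i F) * u)

lemma nab_apply (ι : MvPolynomial (Fin n) K →ₐ[K] A) (d : Fin n → Derivation K A A)
    (F : MvPolynomial (Fin n) K) (u : A) (s : K) (i : Fin n) (v : A) :
    nab ι d F u s i v = d i v + s • (ι (pderiv i F) * u * v) := rfl

/-- pole order filtration -/
def phi (ι : MvPolynomial (Fin n) K →ₐ[K] A)
    (F : MvPolynomial (Fin n) K) (u : A) (j : ℕ) : Submodule K A :=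
  Submodule.map ((LinearMap.mulRight K (u ^ j)).comp ι.toLinearMap)
    (restrictTotalDegree (Fin n) K ((F.totalDegree + 1) * j))

lemma mem_phi (ι : MvPolynomial (Fin n) K →ₐ[K] A)
    (F : MvPolynomial (Fin n) K) (u : A) (j : ℕ) (v : A) :
    v ∈ phi ι F u j ↔ ∃ p : MvPolynomial (Fin n) K,
      p.totalDegree ≤ (F.totalDegree + 1) * j ∧ ι p * u ^ j = v := by
  simp [phi, Submodule.mem_map, mem_restrictTotalDegree]

lemma finrank_restrictTotalDegree_le (N : ℕ) :
    FiniteDimensional K (restrictTotalDegree (Fin n) K N) ∧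
    Module.finrank K (restrictTotalDegree (Fin n) K N) ≤ (N + 1) ^ n := by
  let f : (Fin n → Fin (N + 1)) → MvPolynomial (Fin n) K := fun c =>
    monomial (Finsupp.equivFunOnFinite.symm (fun i => (c i : ℕ))) 1
  have hle : restrictTotalDegree (Fin n) K N ≤ Submodule.span K (Set.range f) := by
    intro p hp
    rw [mem_restrictTotalDegree] at hp
    rw [← support_sum_monomial_coeff p]
    refine Submodule.sum_mem _ fun γ hγ => ?_
    have h1 := (le_totalDegree hγ).trans hp
    rw [Finsupp.sum_fintype _ _ (fun _ => rfl)] at h1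
    have h2 : ∀ i, γ i < N + 1 := fun i => Nat.lt_succ_of_le
      ((Finset.single_le_sum (f := fun i => γ i) (fun _ _ => Nat.zero_le _) (Finset.mem_univ i)).trans h1)
    have h3 : monomial γ (coeff γ p) = coeff γ p • f (fun i => ⟨γ i, h2 i⟩) := by
      simp only [f, smul_monomial, smul_eq_mul, mul_one]
      have : Finsupp.equivFunOnFinite.symm (fun i => γ i) = γ := by ext; simp
      rw [this]
    rw [h3]
    exact Submodule.smul_mem _ _ (Submodule.subset_span ⟨_, rfl⟩)
  have hfd : FiniteDimensional K (Submodule.span K (Set.range f)) :=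
    FiniteDimensional.span_of_finite K (Set.finite_range f)
  refine ⟨Submodule.finiteDimensional_of_le hle, (Submodule.finrank_mono hle).trans ?_⟩
  refine (finrank_range_le_card f).trans ?_
  simp

lemma totalDegree_pderiv_le'' (p : MvPolynomial (Fin n) K) (i : Fin n) :
    (pderiv i p).totalDegree ≤ p.totalDegree :=
  totalDegree_pderiv_le' p i _ (Nat.le_succ _)

lemma bs_abstract [CharZero K] (ι : MvPolynomial (Fin n) K →ₐ[K] A) (hι : Function.Injective ι)
    (d : Fin n → Derivation K A A) (hdd : ∀ i j v, d i (d j v) = d j (d i v))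
    (hd : ∀ i p, d i (ι p) = ι (pderiv i p))
    (F : MvPolynomial (Fin n) K) (u : A) (hu : ι F * u = 1) (s : K) (G : MvPolynomial (Fin n) K) :
    ∃ (m L : ℕ) (q : MvPolynomial (Fin n) K) (h : Fin n → MvPolynomial (Fin n) K),
      G * F ^ (m + L + 1) = q * F ^ (m + L + 2) +
        ∑ i, (F * pderiv i (h i) + C (s - L) * h i * pderiv i F) := by
  classical
  set D := nab ι d F u s with hDdef
  let x : Fin n → Module.End K A := fun i => LinearMap.mulLeft K (ι (X i))
  have hdu : ∀ i, d i u = - (ι (pderiv i F) * u ^ 2) := by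
    intro i
    have h1 : d i (ι F * u) = 0 := by rw [hu]; simp
    rw [Derivation.leibniz, hd, smul_eq_mul, smul_eq_mul] at h1
    have : u * (ι F * d i u + u * ι (pderiv i F)) = 0 := by rw [h1, mul_zero]
    linear_combination this - (d i u) * hu
  have hdupow : ∀ i (L : ℕ), d i (u ^ L) = - (L : A) * (ι (pderiv i F) * u ^ (L + 1)) := by
    intro i L
    induction L with
    | zero => simp
    | succ L ih =>
      rw [pow_succ, Derivation.leibniz, ih, hdu, smul_eq_mul, smul_eq_mul]
      push_cast; ring
  have hDpow : ∀ i (p : MvPolynomial (Fin n) K) (L : ℕ), D i (ι p * u ^ L) =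
      ι (F * pderiv i p + C (s - L) * p * pderiv i F) * u ^ (L + 1) := by
    intro i p L
    rw [hDdef, nab_apply, Derivation.leibniz, hdupow, hd, smul_eq_mul, smul_eq_mul]
    have hC : ι (C (s - L)) = algebraMap K A s - L := by
      have : ι (C (s - L)) = algebraMap K A (s - L) := ι.commutes _
      rw [this, map_sub, map_natCast]
    simp only [map_add, map_mul, hC, Algebra.smul_def]
    linear_combination (- u ^ L * ι (pderiv i p)) * hu
  have hxx : ∀ i j, x i * x j = x j * x i := by
    intro i j; ext v; simp only [x, Module.End.mul_apply, LinearMap.mulLeft_apply]; ring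
  have hpp : ∀ i j, pderiv i (pderiv j F) = pderiv j (pderiv i F) := by
    intro i j
    apply hι
    rw [← hd, ← hd, ← hd, ← hd, hdd]
  have hDD : ∀ i j, D i * D j = D j * D i := by
    intro i j; ext v
    simp only [Module.End.mul_apply, hDdef, nab_apply, map_add, Derivation.map_algebraMap,
      Derivation.leibniz, hdu, smul_eq_mul, hd, hdd i j v, hpp i j, Algebra.smul_def]
    ring
  have hDx : ∀ i j, D i * x j = x j * D i + (if j = i then 1 else 0) := by
    intro i j; ext v
    simp only [Module.End.mul_apply, LinearMap.add_apply, hDdef, nab_apply, x,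
      LinearMap.mulLeft_apply, Derivation.leibniz, hd, smul_eq_mul, pderiv_X, Algebra.smul_def]
    by_cases hij : j = i
    · subst hij; simp; ring
    · simp [hij]; ring
  set Φ := phi ι F u with hΦ
  have hstep : ∀ j (p : MvPolynomial (Fin n) K), p.totalDegree ≤ (F.totalDegree + 1) * (j + 1) →
      ι p * u ^ (j + 1) ∈ Φ (j + 1) := fun j p hp => (mem_phi ι F u _ _).2 ⟨p, hp, rfl⟩
  have hmono : Monotone Φ := by
    refine monotone_nat_of_le_succ fun j v hv => ?_
    obtain ⟨p, hp, rfl⟩ := (mem_phi ι F u _ _).1 hv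
    have : ι p * u ^ j = ι (p * F) * u ^ (j + 1) := by
      rw [map_mul, pow_succ]; linear_combination (- ι p * u ^ j) * hu
    rw [this]
    apply hstep
    refine (totalDegree_mul _ _).trans ?_
    rw [mul_add]; omega
  have hfin : ∀ j, FiniteDimensional K (Φ j) := by
    intro j
    have := (finrank_restrictTotalDegree_le (K := K) (n := n) ((F.totalDegree + 1) * j)).1
    rw [hΦ, phi]; infer_instance
  have hc : ∀ j, Module.finrank K (Φ j) ≤ ((F.totalDegree + 1) * (j + 1)) ^ n := by
    intro j
    have h1 := finrank_restrictTotalDegree_le (K := K) (n := n) ((F.totalDegree + 1) * j)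
    have := h1.1
    refine (Submodule.finrank_map_le _ _).trans (h1.2.trans (Nat.pow_le_pow_left ?_ n))
    rw [mul_add]; omega
  have hx : ∀ i j, ∀ v ∈ Φ j, x i v ∈ Φ (j + 1) := by
    intro i j v hv
    obtain ⟨p, hp, rfl⟩ := (mem_phi ι F u _ _).1 hv
    have : x i (ι p * u ^ j) = ι (X i * p * F) * u ^ (j + 1) := by
      simp only [x, LinearMap.mulLeft_apply]
      rw [map_mul, map_mul, pow_succ]; linear_combination (- ι (X i) * ι p * u ^ j) * hu
    rw [this]
    apply hstep
    refine (totalDegree_mul _ _).trans ((add_le_add_left (totalDegree_mul _ _) _).trans ?_)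
    rw [totalDegree_X, mul_add]; omega
  have hD : ∀ i j, ∀ v ∈ Φ j, D i v ∈ Φ (j + 1) := by
    intro i j v hv
    obtain ⟨p, hp, rfl⟩ := (mem_phi ι F u _ _).1 hv
    rw [hDpow]
    apply hstep
    have h1 := totalDegree_pderiv_le'' p i
    have h2 := totalDegree_pderiv_le'' F i
    refine (totalDegree_add _ _).trans (max_le ?_ ?_)
    · refine (totalDegree_mul _ _).trans ?_
      rw [mul_add]; omega
    · refine (totalDegree_mul _ _).trans ((add_le_add_left (totalDegree_mul _ _) _).trans ?_)
      rw [totalDegree_C, mul_add]; omega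
  -- the module M
  set M : Submodule K A := ⨆ j, Φ j with hM
  have hMmem : ∀ v, v ∈ M ↔ ∃ j, v ∈ Φ j := fun v =>
    Submodule.mem_iSup_of_directed _ hmono.directed_le
  have hMD : ∀ i, ∀ v ∈ M, D i v ∈ M := by
    intro i v hv
    obtain ⟨j, hj⟩ := (hMmem v).1 hv
    exact (hMmem _).2 ⟨j + 1, hD i j v hj⟩
  have hMF : ∀ (p : MvPolynomial (Fin n) K), ι p ∈ M := by
    intro p
    refine (hMmem _).2 ⟨p.totalDegree, (mem_phi ι F u _ _).2 ⟨p * F ^ p.totalDegree, ?_, ?_⟩⟩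
    · refine (totalDegree_mul _ _).trans ?_
      have := totalDegree_pow F p.totalDegree
      rw [add_mul, mul_comm F.totalDegree]; omega
    · rw [map_mul, map_pow, mul_assoc, ← mul_pow, hu, one_pow, mul_one]
  let N : ℕ → Submodule K A := fun m => sInf {S | (∀ p, ι (p * F ^ m) ∈ S) ∧
    ∀ i, ∀ v ∈ S, D i v ∈ S}
  have hNle : ∀ m (S : Submodule K A), (∀ p, ι (p * F ^ m) ∈ S) → (∀ i, ∀ v ∈ S, D i v ∈ S) →
      N m ≤ S := fun m S h1 h2 => sInf_le ⟨h1, h2⟩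
  have hN1 : ∀ m p, ι (p * F ^ m) ∈ N m := by
    intro m p
    rw [Submodule.mem_sInf]
    rintro S ⟨h1, -⟩
    exact h1 p
  have hND : ∀ m i, ∀ v ∈ N m, D i v ∈ N m := by
    intro m i v hv
    rw [Submodule.mem_sInf] at hv ⊢
    rintro S ⟨h1, h2⟩
    exact h2 i v (hv S ⟨h1, h2⟩)
  have hanti : ∀ m, N (m + 1) ≤ N m := by
    intro m
    refine hNle _ _ (fun p => ?_) (hND m)
    have := hN1 m (p * F)
    rwa [mul_assoc, ← pow_succ'] at this
  have hNx : ∀ m i, ∀ v ∈ N m, x i v ∈ N m := by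
    intro m i v hv
    have : N m ≤ N m ⊓ ⨅ j, (N m).comap (x j) := by
      refine hNle _ _ (fun p => ?_) ?_
      · refine ⟨hN1 m p, ?_⟩
        rw [SetLike.mem_coe, Submodule.mem_iInf]
        intro j
        have := hN1 m (X j * p)
        rw [mul_assoc, map_mul] at this
        exact this
      · rintro k w ⟨hw1, hw2⟩
        rw [SetLike.mem_coe, Submodule.mem_iInf] at hw2
        refine ⟨hND m k w hw1, ?_⟩
        rw [SetLike.mem_coe, Submodule.mem_iInf]
        intro j
        rw [Submodule.mem_comap]
        have h1 := LinearMap.congr_fun (hDx k j) w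
        simp only [Module.End.mul_apply, LinearMap.add_apply] at h1
        replace h1 := eq_sub_iff_add_eq.2 h1.symm
        rw [h1]
        refine Submodule.sub_mem _ (hND m k _ (hw2 j)) ?_
        split_ifs
        · exact hw1
        · exact Submodule.zero_mem _
    have h2 := (this hv).2
    rw [SetLike.mem_coe, Submodule.mem_iInf] at h2
    exact h2 i
  have hNM : ∀ m, N m ≤ M := fun m => hNle _ _ (fun p => hMF _) hMD
  obtain ⟨m, hm⟩ := bernstein_chain x D hxx hDD hDx Φ hmono hfin hx hD (F.totalDegree + 1) hc N hanti hNx hND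
    (fun m v hv => (hMmem v).1 (hNM m hv))
  let T : Submodule K A :=
    { carrier := {v | ∃ (q : MvPolynomial (Fin n) K) (w : Fin n → A), (∀ i, w i ∈ M) ∧
        v = ι (q * F ^ (m + 1)) + ∑ i, D i (w i)}
      zero_mem' := ⟨0, 0, fun i => Submodule.zero_mem _, by simp⟩
      add_mem' := by
        rintro _ _ ⟨q, w, hw, rfl⟩ ⟨q', w', hw', rfl⟩
        refine ⟨q + q', w + w', fun i => Submodule.add_mem _ (hw i) (hw' i), ?_⟩
        simp only [Pi.add_apply, map_add, Finset.sum_add_distrib, add_mul]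
        abel
      smul_mem' := by
        rintro c _ ⟨q, w, hw, rfl⟩
        refine ⟨c • q, c • w, fun i => Submodule.smul_mem _ _ (hw i), ?_⟩
        simp only [Pi.smul_apply, map_smul, smul_add, Finset.smul_sum, smul_mul_assoc] }
  have hT : N (m + 1) ≤ M ⊓ T := by
    refine hNle _ _ (fun p => ⟨hMF _, p, 0, fun i => Submodule.zero_mem _, by simp⟩) ?_
    rintro i v ⟨hv, -⟩
    refine ⟨hMD i v hv, 0, Pi.single i v, fun j => ?_, ?_⟩
    · by_cases hj : j = i
      · subst hj; simpa using hv
      · simp [hj]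
    · rw [Finset.sum_eq_single i]
      · simp
      · intro j _ hj; simp [hj]
      · simp
  obtain ⟨q, w, hw, heq⟩ := (hT (hm (hN1 m G))).2
  choose l hl using fun i => (hMmem _).1 (hw i)
  set L := Finset.univ.sup l with hL
  have hl' : ∀ i, w i ∈ Φ L := fun i => hmono (Finset.le_sup (Finset.mem_univ i)) (hl i)
  choose h hh1 hh using fun i => (mem_phi ι F u _ _).1 (hl' i)
  refine ⟨m, L, q, h, hι ?_⟩
  have hFu : ι F ^ (L + 1) * u ^ (L + 1) = 1 := by rw [← mul_pow, hu, one_pow]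
  simp only [← hh, hDpow] at heq
  rw [← Finset.sum_mul, ← map_sum] at heq
  rw [map_add]
  simp only [map_mul, map_pow] at heq ⊢
  set S := ι (∑ i, (F * pderiv i (h i) + C (s - L) * h i * pderiv i F)) with hS
  linear_combination (ι F ^ (L + 1)) * heq + S * hFu

end Conn


section Inst
open MvPolynomial

lemma clear_denoms {n : ℕ} (q : MvPolynomial (Fin n) (FractionRing (Polynomial ℚ))) :
    ∃ (b : Polynomial ℚ), b ≠ 0 ∧ ∃ q' : MvPolynomial (Fin n) (Polynomial ℚ),
      map (algebraMap _ _) q' = C (algebraMap (Polynomial ℚ) _ b) * q := by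
  obtain ⟨b, hb⟩ := IsLocalization.exist_integer_multiples (nonZeroDivisors (Polynomial ℚ))
    q.support (fun γ => coeff γ q)
  refine ⟨b, nonZeroDivisors.ne_zero b.2, ?_⟩
  choose! c hc using hb
  refine ⟨∑ γ ∈ q.support, monomial γ (c γ), ?_⟩
  conv_rhs => rw [← support_sum_monomial_coeff q]
  rw [map_sum, Finset.mul_sum]
  refine Finset.sum_congr rfl fun γ hγ => ?_
  rw [map_monomial, hc γ hγ, C_mul_monomial, Algebra.smul_def]

/-- Taylor expansion at a point -/
def taylorHom {n : ℕ} {K : Type*} [Field K] (c : Fin n → K) :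
    MvPolynomial (Fin n) K →ₐ[K] MvPowerSeries (Fin n) K :=
  (coeToMvPowerSeries.algHom K).comp (aeval (fun i => X i + C (c i)))

lemma taylorHom_apply {n : ℕ} {K : Type*} [Field K] (c : Fin n → K) (p : MvPolynomial (Fin n) K) :
    taylorHom c p = ((aeval (fun i => X i + C (c i)) p : MvPolynomial (Fin n) K) :
      MvPowerSeries (Fin n) K) := by
  simp [taylorHom, coeToMvPowerSeries.algHom_apply]

lemma taylorHom_injective {n : ℕ} {K : Type*} [Field K] (c : Fin n → K) :
    Function.Injective (taylorHom c) := by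
  intro p q h
  rw [taylorHom_apply, taylorHom_apply, MvPolynomial.coe_inj] at h
  have hid : ∀ p : MvPolynomial (Fin n) K, aeval (fun i => X i - C (c i) : Fin n → MvPolynomial (Fin n) K)
      (aeval (fun i => X i + C (c i) : Fin n → MvPolynomial (Fin n) K) p) = p := by
    intro p
    have : (aeval (fun i => X i - C (c i) : Fin n → MvPolynomial (Fin n) K)).comp
      (aeval (fun i => X i + C (c i) : Fin n → MvPolynomial (Fin n) K)) = AlgHom.id K _ := by
      ext i
      simp [algHom_C]
    exact DFunLike.congr_fun this p
  rw [← hid p, h, hid]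

lemma taylorHom_pderiv {n : ℕ} {K : Type*} [Field K] (c : Fin n → K) (i : Fin n)
    (p : MvPolynomial (Fin n) K) :
    MvPowerSeries.pderiv K i (taylorHom c p) = taylorHom c (pderiv i p) := by
  rw [taylorHom_apply, taylorHom_apply, MvPowerSeries.pderiv_coe, MvPolynomial.coe_inj]
  induction p using MvPolynomial.induction_on with
  | C a => simp [algHom_C]
  | add p q hp hq => simp only [map_add, hp, hq]
  | mul_X p j hp =>
    simp only [map_mul, Derivation.leibniz, hp, aeval_X, map_add, pderiv_C, smul_eq_mul, pderiv_X]
    by_cases hij : j = i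
    · subst hij; simp
    · simp [hij, Pi.single_apply, Ne.symm hij]

lemma ps_pderiv_comm {n : ℕ} {K : Type*} [Field K] (i j : Fin n) (v : MvPowerSeries (Fin n) K) :
    MvPowerSeries.pderiv K i (MvPowerSeries.pderiv K j v) =
    MvPowerSeries.pderiv K j (MvPowerSeries.pderiv K i v) := by
  ext γ
  simp only [MvPowerSeries.coeff_pderiv]
  by_cases hij : j = i
  · subst hij; rfl
  · rw [add_right_comm γ]
    simp [Finsupp.single_apply, hij, Ne.symm hij]
    ring

lemma bs_key {n : ℕ} (F G : MvPolynomial (Fin n) ℚ) (hF : F ≠ 0) :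
    ∃ (b : Polynomial ℚ) (m L : ℕ) (q : MvPolynomial (Fin n) (Polynomial ℚ))
      (h : Fin n → MvPolynomial (Fin n) (Polynomial ℚ)), b ≠ 0 ∧
      C b * map Polynomial.C G * (map Polynomial.C F) ^ (m + L + 1) =
        q * (map Polynomial.C F) ^ (m + L + 2) +
        ∑ i, (map Polynomial.C F * pderiv i (h i) +
          C (Polynomial.X - Polynomial.C (L : ℚ)) * h i * pderiv i (map Polynomial.C F)) := by
  classical
  let K := FractionRing (Polynomial ℚ)
  let φ : Polynomial ℚ →+* K := algebraMap _ _
  have hφ : Function.Injective φ := IsFractionRing.injective _ _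
  have hmφ : Function.Injective (map φ : MvPolynomial (Fin n) _ → MvPolynomial (Fin n) K) :=
    map_injective _ hφ
  obtain ⟨c, hc⟩ : ∃ c : Fin n → ℚ, eval c F ≠ 0 := by
    by_contra! hcon
    exact hF (MvPolynomial.funext fun x => by simp [hcon x])
  have : CharZero K := charZero_of_injective_algebraMap (R := Polynomial ℚ) hφ
  let F1 : MvPolynomial (Fin n) (Polynomial ℚ) := map Polynomial.C F
  let G1 : MvPolynomial (Fin n) (Polynomial ℚ) := map Polynomial.C G
  let c' : Fin n → K := fun i => φ (Polynomial.C (c i))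
  have hunit : IsUnit (taylorHom c' (map φ F1)) := by
    rw [MvPowerSeries.isUnit_iff_constantCoeff, isUnit_iff_ne_zero, taylorHom_apply]
    have : MvPowerSeries.constantCoeff ((aeval (fun i => X i + C (c' i)) (map φ F1) :
        MvPolynomial (Fin n) K) : MvPowerSeries (Fin n) K) = φ (Polynomial.C (eval c F)) := by
      rw [← MvPowerSeries.coeff_zero_eq_constantCoeff_apply, MvPolynomial.coeff_coe]
      change constantCoeff _ = _
      simp only [F1]
      clear hc hF
      induction F using MvPolynomial.induction_on with
      | C a => simp [algHom_C]
      | add p q hp hq => simp only [map_add, hp, hq]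
      | mul_X p j hp => simp only [map_mul, hp, map_X, aeval_X, map_add, constantCoeff_X,
          constantCoeff_C, eval_X, zero_add, c']
    rw [this]
    exact fun h0 => hc (by simpa using Polynomial.C_injective (hφ (by simpa using h0)))
  obtain ⟨u, hu⟩ := hunit.exists_right_inv
  obtain ⟨m, L, q, h, hq⟩ := bs_abstract (taylorHom c') (taylorHom_injective c')
    (fun i => MvPowerSeries.pderiv K i) ps_pderiv_comm (taylorHom_pderiv c') (map φ F1) u hu
    (φ Polynomial.X) (map φ G1)
  obtain ⟨b0, hb0, q', hq'⟩ := clear_denoms q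
  replace hq' : map φ q' = C (φ b0) * q := hq'
  choose b hb h' hh' using fun i => clear_denoms (h i)
  replace hh' : ∀ i, map φ (h' i) = C (φ (b i)) * h i := hh'
  let B := ∏ i, b i
  have hB : ∀ i, ∃ r, B = r * b i := fun i => by
    obtain ⟨r, hr⟩ := Finset.dvd_prod_of_mem b (Finset.mem_univ i)
    exact ⟨r, by rw [mul_comm]; exact hr⟩
  choose r hr using hB
  refine ⟨b0 * B, m, L, C B * q', fun i => C (b0 * r i) * h' i,
    mul_ne_zero hb0 (Finset.prod_ne_zero_iff.2 fun i _ => hb i), hmφ ?_⟩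
  have key := congrArg (fun z => C (φ (b0 * B)) * z) hq
  beta_reduce at key
  have hpd : ∀ (i : Fin n) (p : MvPolynomial (Fin n) (Polynomial ℚ)),
      map φ (pderiv i p) = pderiv i (map φ p) := fun i p => (pderiv_map).symm
  have e1 : C (φ (b0 * B)) * q = map φ (C B * q') := by
    simp only [map_mul, hq', map_C]; ring
  have e2 : ∀ i, C (φ (b0 * B)) * h i = map φ (C (b0 * r i) * h' i) := by
    intro i
    simp only [map_mul, hh', map_C, hr i]; ring
  rw [mul_add, ← mul_assoc, ← mul_assoc, e1, Finset.mul_sum] at key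
  rw [map_add, map_sum, map_mul, map_mul, map_mul _ (C B * q')]
  simp only [map_pow]
  rw [map_C]
  refine key.trans ?_
  congr 1
  refine Finset.sum_congr rfl fun i _ => ?_
  have e2' := e2 i
  generalize C (b0 * r i) * h' i = w at e2' ⊢
  simp only [map_add, map_mul (map φ), hpd, ← e2', map_C]
  simp only [Derivation.leibniz, pderiv_C, smul_eq_mul, map_sub]
  have : φ (Polynomial.C (L:ℚ)) = (L : K) := by simp [φ]
  rw [this]
  ring

end Inst


section Cube
open MvPolynomial Set

/-- Lebesgue measure on the open unit cube. -/
def cubeM (ι : Type) [Fintype ι] : Measure (ι → ℝ) :=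
  Measure.pi fun _ => (volume : Measure ℝ).restrict (Ioo 0 1)

instance (ι : Type) [Fintype ι] : IsProbabilityMeasure (cubeM ι) := by
  unfold cubeM
  have : IsProbabilityMeasure ((volume : Measure ℝ).restrict (Ioo 0 1)) := ⟨by simp⟩
  infer_instance

lemma cubeM_eq (ι : Type) [Fintype ι] :
    cubeM ι = (volume : Measure (ι → ℝ)).restrict (Set.univ.pi fun _ => Ioo 0 1) :=
  (Measure.restrict_pi_pi _ _).symm

lemma cubeM_ae (ι : Type) [Fintype ι] : ∀ᵐ x ∂(cubeM ι), ∀ i, x i ∈ Ioo (0:ℝ) 1 := by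
  rw [cubeM_eq]
  filter_upwards [ae_restrict_mem (MeasurableSet.univ_pi fun _ => measurableSet_Ioo)] with x hx
  exact fun i => hx i (mem_univ i)

/-- Periods given by rational functions on the unit cube. -/
def CubePeriod (x : ℝ) : Prop :=
  ∃ (ι : Type) (_ : Fintype ι) (p q : MvPolynomial ι ℚ),
    Integrable (fun y => (aeval y p : ℝ) / (aeval y q : ℝ)) (cubeM ι) ∧
    (∀ y : ι → ℝ, (∀ i, y i ∈ Ioo (0:ℝ) 1) → 0 < (aeval y q : ℝ)) ∧
    x = ∫ y, (aeval y p : ℝ) / (aeval y q : ℝ) ∂(cubeM ι)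

lemma cube_sum (ι κ : Type) [Fintype ι] [Fintype κ] :
    MeasurePreserving (MeasurableEquiv.sumPiEquivProdPi (fun _ : ι ⊕ κ => ℝ)) (cubeM (ι ⊕ κ))
      ((cubeM ι).prod (cubeM κ)) :=
  measurePreserving_sumPiEquivProdPi (fun _ : ι ⊕ κ => (volume : Measure ℝ).restrict (Ioo 0 1))

lemma cube_inl (ι κ : Type) [Fintype ι] [Fintype κ] :
    MeasurePreserving (fun z : ι ⊕ κ → ℝ => fun i => z (Sum.inl i)) (cubeM (ι ⊕ κ)) (cubeM ι) :=
  measurePreserving_fst.comp (cube_sum ι κ)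

lemma cube_inr (ι κ : Type) [Fintype ι] [Fintype κ] :
    MeasurePreserving (fun z : ι ⊕ κ → ℝ => fun i => z (Sum.inr i)) (cubeM (ι ⊕ κ)) (cubeM κ) :=
  measurePreserving_snd.comp (cube_sum ι κ)

lemma cubePeriod_add {x y : ℝ} (hx : CubePeriod x) (hy : CubePeriod y) : CubePeriod (x + y) := by
  obtain ⟨ι, _, p, q, h1, h2, rfl⟩ := hx
  obtain ⟨κ, _, p', q', h1', h2', rfl⟩ := hy
  have hi := (cube_inl ι κ).integrable_comp_of_integrable h1
  have hr := (cube_inr ι κ).integrable_comp_of_integrable h1'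
  have hae : (fun z : ι ⊕ κ → ℝ =>
      (aeval z (rename Sum.inl p * rename Sum.inr q' + rename Sum.inr p' * rename Sum.inl q) : ℝ) /
      (aeval z (rename Sum.inl q * rename Sum.inr q') : ℝ)) =ᵐ[cubeM (ι ⊕ κ)]
      ((fun y => (aeval y p : ℝ) / (aeval y q : ℝ)) ∘ fun z => fun i => z (Sum.inl i)) +
      ((fun y => (aeval y p' : ℝ) / (aeval y q' : ℝ)) ∘ fun z => fun i => z (Sum.inr i)) := by
    filter_upwards [cubeM_ae (ι ⊕ κ)] with z hz
    have e1 := h2 (fun i => z (Sum.inl i)) (fun i => hz _)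
    have e2 := h2' (fun i => z (Sum.inr i)) (fun i => hz _)
    simp only [map_add, map_mul, aeval_rename, Pi.add_apply, Function.comp_apply]
    change (aeval (fun i => z (Sum.inl i)) p * aeval (fun i => z (Sum.inr i)) q' +
      aeval (fun i => z (Sum.inr i)) p' * aeval (fun i => z (Sum.inl i)) q) /
      (aeval (fun i => z (Sum.inl i)) q * aeval (fun i => z (Sum.inr i)) q') = _
    field_simp
  refine ⟨ι ⊕ κ, inferInstance, _, _, (integrable_congr hae).2 (hi.add hr), ?_, ?_⟩
  · intro z hz
    simp only [map_mul, aeval_rename]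
    exact mul_pos (h2 _ fun i => hz _) (h2' _ fun i => hz _)
  · rw [integral_congr_ae hae]
    simp only [Pi.add_apply]
    rw [integral_add hi hr]
    congr 1
    · rw [← (cube_inl ι κ).map_eq, integral_map]
      · rfl
      · exact (cube_inl ι κ).measurable.aemeasurable
      · rw [(cube_inl ι κ).map_eq]; exact h1.1
    · rw [← (cube_inr ι κ).map_eq, integral_map]
      · rfl
      · exact (cube_inr ι κ).measurable.aemeasurable
      · rw [(cube_inr ι κ).map_eq]; exact h1'.1

lemma cubePeriod_smul (c : ℚ) {x : ℝ} (hx : CubePeriod x) : CubePeriod (c * x) := by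
  obtain ⟨ι, _, p, q, h1, h2, rfl⟩ := hx
  refine ⟨ι, inferInstance, C c * p, q, ?_, h2, ?_⟩
  · simpa [mul_div_assoc] using h1.const_mul (c : ℝ)
  · simp [mul_div_assoc, integral_const_mul]

lemma cubePeriod_zero : CubePeriod 0 :=
  ⟨Empty, inferInstance, 0, 1, by simp, by simp, by simp⟩

/-- The rational vector space of cube periods inside the complex numbers. -/
def cubeV : Submodule ℚ ℂ where
  carrier := {z | ∃ x : ℝ, CubePeriod x ∧ z = x}
  zero_mem' := ⟨0, cubePeriod_zero, by simp⟩
  add_mem' := by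
    rintro _ _ ⟨x, hx, rfl⟩ ⟨y, hy, rfl⟩
    exact ⟨x + y, cubePeriod_add hx hy, by simp⟩
  smul_mem' := by
    rintro c _ ⟨x, hx, rfl⟩
    exact ⟨c * x, cubePeriod_smul c hx, by simp [Rat.smul_def]⟩

lemma alg_coeff {m : ℕ} (p : MvPolynomial (Fin m) ℚ) (d : Fin m →₀ ℕ) :
    IsAlgebraic ℚ ((map (algebraMap ℚ ℝ) p).coeff d) := by
  rw [coeff_map]; exact isAlgebraic_algebraMap _

lemma semiArith_cube (m : ℕ) :
    IsSemiArithmetic (Set.univ.pi fun _ : Fin m => Ioo (0:ℝ) 1) := by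
  refine ⟨1, fun _ => m + m, fun _ j => map (algebraMap ℚ ℝ)
    (Fin.addCases (fun i => X i) (fun i => 1 - X i) j), fun _ _ => false,
    fun i j d => alg_coeff _ _, ?_⟩
  ext x
  simp only [mem_pi, mem_univ, true_implies, mem_iUnion, mem_iInter]
  constructor
  · intro h
    refine ⟨0, fun j => ?_⟩
    refine Fin.addCases (fun i => ?_) (fun i => ?_) j
    · simp [(h i).1]
    · simp only [Fin.addCases_right]
      simp [(h i).2]
  · rintro ⟨-, h⟩ i
    have h1 := h (Fin.castAdd m i)
    have h2 := h (Fin.natAdd m i)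
    simp only [Fin.addCases_left, Fin.addCases_right] at h1 h2
    simp at h1 h2
    exact ⟨h1, h2⟩

lemma CubePeriod.isRealPeriod {x : ℝ} (hx : CubePeriod x) : IsRealPeriod x := by
  obtain ⟨ι, _, p, q, h1, h2, rfl⟩ := hx
  let e := Fintype.equivFin ι
  have hmp : MeasurePreserving (MeasurableEquiv.piCongrLeft (fun _ : ι => ℝ) e.symm)
      (cubeM (Fin (Fintype.card ι))) (cubeM ι) :=
    measurePreserving_piCongrLeft (fun _ : ι => (volume : Measure ℝ).restrict (Ioo 0 1)) e.symm
  have hval : ∀ (z : Fin (Fintype.card ι) → ℝ) (r : MvPolynomial ι ℚ),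
      (aeval (MeasurableEquiv.piCongrLeft (fun _ : ι => ℝ) e.symm z) r : ℝ) =
      eval z (map (algebraMap ℚ ℝ) (rename e r)) := by
    intro z r
    rw [eval_map, ← aeval_def, aeval_rename]
    congr 1
    congr 1
    ext i
    obtain ⟨j, rfl⟩ := e.symm.surjective i
    simp [MeasurableEquiv.coe_piCongrLeft, Equiv.piCongrLeft_apply_apply]
  refine ⟨Fintype.card ι, Set.univ.pi fun _ => Ioo (0:ℝ) 1, map (algebraMap ℚ ℝ) (rename e p),
    map (algebraMap ℚ ℝ) (rename e q), semiArith_cube _, alg_coeff _, alg_coeff _, ?_, ?_⟩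
  · unfold IntegrableOn
    rw [← cubeM_eq]
    have := hmp.integrable_comp_of_integrable h1
    refine this.congr (Filter.Eventually.of_forall fun z => ?_)
    simp only [Function.comp_apply, hval]
  · rw [← cubeM_eq, ← hmp.integral_comp (MeasurableEquiv.measurableEmbedding _)]
    simp only [hval]

lemma cubeV_isPeriod {z : ℂ} (hz : z ∈ cubeV) : IsPeriod z := by
  obtain ⟨x, hx, rfl⟩ := hz
  refine ⟨by simpa using hx.isRealPeriod, by simpa using cubePeriod_zero.isRealPeriod⟩

end Cube


section LogPeriod
open MvPolynomial Set

lemma log_int_one {F : ℝ} (hF : 0 < F) :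
    IntegrableOn (fun t : ℝ => (F - 1) / (1 + t * (F - 1))) (Ioo 0 1) ∧
    ∫ t in Ioo (0:ℝ) 1, (F - 1) / (1 + t * (F - 1)) = Real.log F := by
  have hpos : ∀ t ∈ Icc (0:ℝ) 1, 0 < 1 + t * (F - 1) := by
    rintro t ⟨h0, h1⟩
    rcases eq_or_lt_of_le h0 with h | h
    · subst h; simp
    · nlinarith
  have hder : ∀ t ∈ uIcc (0:ℝ) 1, HasDerivAt (fun t => Real.log (1 + t * (F - 1)))
      ((F - 1) / (1 + t * (F - 1))) t := by
    intro t ht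
    rw [uIcc_of_le zero_le_one] at ht
    have : HasDerivAt (fun t : ℝ => 1 + t * (F - 1)) (F - 1) t := by
      simpa using ((hasDerivAt_id t).mul_const (F - 1)).const_add 1
    exact this.log (hpos t ht).ne'
  have hcont : ContinuousOn (fun t : ℝ => (F - 1) / (1 + t * (F - 1))) (Icc 0 1) := by
    refine ContinuousOn.div (by fun_prop) (by fun_prop) fun t ht => (hpos t ht).ne'
  have hi : IntervalIntegrable (fun t : ℝ => (F - 1) / (1 + t * (F - 1))) volume 0 1 :=
    ContinuousOn.intervalIntegrable (by rwa [uIcc_of_le zero_le_one])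
  refine ⟨(hcont.integrableOn_compact isCompact_Icc).mono_set Ioo_subset_Icc_self, ?_⟩
  rw [← integral_Ioc_eq_integral_Ioo, ← intervalIntegral.integral_of_le zero_le_one,
    intervalIntegral.integral_eq_sub_of_hasDerivAt hder hi]
  simp

lemma log_int_abs {F : ℝ} (hF : 0 < F) :
    ∫ t in Ioo (0:ℝ) 1, ‖(F - 1) / (1 + t * (F - 1))‖ = |Real.log F| := by
  have hpos : ∀ t ∈ Ioo (0:ℝ) 1, 0 < 1 + t * (F - 1) := by
    rintro t ⟨h0, h1⟩; nlinarith
  rcases le_total 1 F with h | h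
  · rw [abs_of_nonneg (Real.log_nonneg h), ← (log_int_one hF).2]
    refine setIntegral_congr_fun measurableSet_Ioo fun t ht => ?_
    exact Real.norm_of_nonneg (div_nonneg (by linarith) (hpos t ht).le)
  · rw [abs_of_nonpos (Real.log_nonpos hF.le h), ← (log_int_one hF).2, ← integral_neg]
    refine setIntegral_congr_fun measurableSet_Ioo fun t ht => ?_
    exact Real.norm_of_nonpos (div_nonpos_of_nonpos_of_nonneg (by linarith) (hpos t ht).le)

lemma log_pow_period {ι : Type} [Fintype ι] (F G : MvPolynomial ι ℚ)
    (hF : ∀ x : ι → ℝ, (∀ i, x i ∈ Ioo (0:ℝ) 1) → 0 ≤ (aeval x F : ℝ)) (N k : ℕ) (hN : N ≠ 0)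
    (hint : Integrable (fun x : ι → ℝ => (aeval x G : ℝ) * (aeval x F : ℝ) ^ N *
      (Real.log (aeval x F)) ^ k) (cubeM ι)) :
    CubePeriod (∫ x, (aeval x G : ℝ) * (aeval x F : ℝ) ^ N *
      (Real.log (aeval x F)) ^ k ∂(cubeM ι)) := by
  classical
  let P : MvPolynomial (ι ⊕ Fin k) ℚ := rename Sum.inl (G * F ^ N * (F - 1) ^ k)
  let Q : MvPolynomial (ι ⊕ Fin k) ℚ := ∏ j : Fin k, (1 + X (Sum.inr j) * (rename Sum.inl F - 1))
  let φ : (ι → ℝ) → (Fin k → ℝ) → ℝ := fun x t => (aeval x G : ℝ) * (aeval x F : ℝ) ^ N *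
    ∏ j, (((aeval x F : ℝ) - 1) / (1 + t j * ((aeval x F : ℝ) - 1)))
  have hφ : ∀ z : ι ⊕ Fin k → ℝ, (aeval z P : ℝ) / (aeval z Q : ℝ) =
      φ (fun i => z (Sum.inl i)) (fun j => z (Sum.inr j)) := by
    intro z
    have : ∀ r : MvPolynomial ι ℚ, (aeval (z ∘ Sum.inl) r : ℝ) =
      aeval (fun i => z (Sum.inl i)) r := fun r => rfl
    simp only [P, Q, φ, map_mul, map_pow, map_sub, map_one, map_prod, map_add, aeval_X, aeval_rename,
      Finset.prod_div_distrib, Finset.prod_const, Finset.card_univ, Fintype.card_fin, this]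
    ring
  have hmeas : Measurable (fun z : ι ⊕ Fin k → ℝ => (aeval z P : ℝ) / (aeval z Q : ℝ)) := by
    have : ∀ p : MvPolynomial (ι ⊕ Fin k) ℚ, Continuous fun z : ι ⊕ Fin k → ℝ => (aeval z p : ℝ) := by
      intro p
      simp only [aeval_def, ← eval_map]
      exact continuous_eval _
    exact (this P).measurable.div (this Q).measurable
  let μ := cubeM ι
  let ν := cubeM (Fin k)
  have hφm : AEStronglyMeasurable (Function.uncurry φ) (μ.prod ν) := by
    have h1 : Measurable (Function.uncurry φ) := by
      have := hmeas.comp (MeasurableEquiv.sumPiEquivProdPi (fun _ : ι ⊕ Fin k => ℝ)).symm.measurable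
      convert this using 1
      ext ⟨x, t⟩
      simp only [Function.comp_apply, hφ]
      rfl
    exact h1.aestronglyMeasurable
  have hone : ∀ x, (∀ i, x i ∈ Ioo (0:ℝ) 1) → Integrable (φ x) ν ∧
      ∫ t, φ x t ∂ν = (aeval x G : ℝ) * (aeval x F : ℝ) ^ N * (Real.log (aeval x F)) ^ k ∧
      ∫ t, ‖φ x t‖ ∂ν = ‖(aeval x G : ℝ) * (aeval x F : ℝ) ^ N * (Real.log (aeval x F)) ^ k‖ := by
    intro x hx
    rcases (hF x hx).eq_or_lt with h0 | hpos
    · simp [φ, ← h0, hN]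
    · refine ⟨?_, ?_, ?_⟩
      · refine Integrable.const_mul ?_ _
        exact Integrable.fintype_prod (f := fun _ t => ((aeval x F : ℝ) - 1) / (1 + t * ((aeval x F : ℝ) - 1)))
          (fun _ => (log_int_one hpos).1)
      · simp only [φ]
        rw [integral_const_mul]
        congr 1
        have := integral_fintype_prod_eq_pow (ι := Fin k) (𝕜 := ℝ)
          (fun t => ((aeval x F : ℝ) - 1) / (1 + t * ((aeval x F : ℝ) - 1)))
          (μ := (volume : Measure ℝ).restrict (Ioo 0 1))
        rw [(log_int_one hpos).2, Fintype.card_fin] at this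
        exact this
      · simp only [φ, norm_mul, norm_prod]
        rw [integral_const_mul]
        congr 1
        have := integral_fintype_prod_eq_pow (ι := Fin k) (𝕜 := ℝ)
          (fun t => ‖((aeval x F : ℝ) - 1) / (1 + t * ((aeval x F : ℝ) - 1))‖)
          (μ := (volume : Measure ℝ).restrict (Ioo 0 1))
        rw [log_int_abs hpos, Fintype.card_fin] at this
        rw [norm_pow, Real.norm_eq_abs (Real.log _)]
        exact this
  have hprod : Integrable (Function.uncurry φ) (μ.prod ν) := by
    rw [integrable_prod_iff hφm]
    constructor
    · filter_upwards [cubeM_ae ι] with x hx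
      exact (hone x hx).1
    · refine hint.norm.congr ?_
      filter_upwards [cubeM_ae ι] with x hx
      exact (hone x hx).2.2.symm
  refine ⟨ι ⊕ Fin k, inferInstance, P, Q, ?_, ?_, ?_⟩
  · simp only [hφ]
    exact (cube_sum ι (Fin k)).integrable_comp_of_integrable hprod
  · intro z hz
    simp only [Q, map_prod, map_add, map_one, map_mul, map_sub, aeval_X, aeval_rename]
    refine Finset.prod_pos fun j _ => ?_
    have h1 := hz (Sum.inr j)
    have h2 : (0:ℝ) ≤ aeval (z ∘ Sum.inl) F := hF _ fun i => hz _
    nlinarith [h1.1, h1.2, mul_nonneg h1.1.le h2]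
  · simp only [hφ]
    have := (cube_sum ι (Fin k)).integral_comp (MeasurableEquiv.measurableEmbedding _) (Function.uncurry φ)
    refine Eq.trans ?_ this.symm
    rw [integral_prod _ hprod]
    refine integral_congr_ae ?_
    filter_upwards [cubeM_ae ι] with x hx
    exact (hone x hx).2.1.symm

end LogPeriod


section ZAnalytic
open Set Filter

lemma norm_ofReal_cpow_le {y B δ : ℝ} {s : ℂ} (hy0 : 0 ≤ y) (hyB : y ≤ B) (hB : 1 ≤ B) (hδ : 0 < δ)
    (hs1 : δ ≤ s.re) (hs2 : s.re ≤ 3 * δ) (k : ℕ) :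
    ‖(y : ℂ) ^ s * (Real.log y : ℂ) ^ k‖ ≤ ((k + 1) / δ) ^ k + B ^ (3 * δ) * B ^ k := by
  have hc1 : 0 ≤ (((k:ℝ) + 1) / δ) ^ k := by positivity
  have hc2 : 0 ≤ B ^ (3 * δ) * B ^ k := by positivity
  rcases hy0.eq_or_lt with rfl | hy
  · have : s ≠ 0 := by rintro rfl; simp at hs1; linarith
    simp only [ofReal_zero, zero_cpow this, zero_mul, norm_zero]
    positivity
  rw [norm_mul, norm_cpow_eq_rpow_re_of_pos hy, norm_pow, norm_real, Real.norm_eq_abs]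
  rcases le_total y 1 with h | h
  · have h1 : y ^ s.re ≤ y ^ δ := Real.rpow_le_rpow_of_exponent_ge hy h hs1
    set ε := δ / (k + 1) with hε
    have hεp : 0 < ε := by positivity
    have h2 := (Real.abs_log_mul_self_rpow_lt y ε hy h hεp).le
    rw [abs_mul, abs_of_nonneg (Real.rpow_nonneg hy.le _)] at h2
    have h3 : y ^ δ = y ^ ε * (y ^ ε) ^ k := by
      rw [← Real.rpow_natCast, ← Real.rpow_mul hy.le, ← Real.rpow_add hy]
      congr 1; rw [hε]; field_simp; ring
    have h4 : y ^ ε ≤ 1 := Real.rpow_le_one hy.le h hεp.le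
    have h5 : (1 / ε) = (k + 1) / δ := by rw [hε]; field_simp
    calc y ^ s.re * |Real.log y| ^ k ≤ y ^ δ * |Real.log y| ^ k := by gcongr
      _ = y ^ ε * (|Real.log y| * y ^ ε) ^ k := by rw [h3, mul_pow]; ring
      _ ≤ 1 * ((k + 1) / δ) ^ k := by
        rw [← h5]; gcongr
      _ ≤ _ := by linarith
  · have h1 : y ^ s.re ≤ B ^ (3 * δ) :=
      (Real.rpow_le_rpow hy.le hyB (by linarith)).trans (Real.rpow_le_rpow_of_exponent_le hB hs2)
    have h2 : |Real.log y| ≤ B := by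
      rw [abs_of_nonneg (Real.log_nonneg h)]
      linarith [Real.log_le_sub_one_of_pos hy]
    calc y ^ s.re * |Real.log y| ^ k ≤ B ^ (3 * δ) * B ^ k := by gcongr
      _ ≤ _ := by linarith

variable {α : Type*} [MeasurableSpace α] (μ : Measure α) [IsFiniteMeasure μ]

/-- derivatives of the zeta function -/
def Zk (f g : α → ℝ) (k : ℕ) (s : ℂ) : ℂ :=
  ∫ x, (g x : ℂ) * ((f x : ℂ) ^ s * (Real.log (f x) : ℂ) ^ k) ∂μ

lemma Zk_aesm {f g : α → ℝ} (hf : Measurable f) (hg : Measurable g) (k : ℕ) (s : ℂ) :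
    AEStronglyMeasurable (fun x => (g x : ℂ) * ((f x : ℂ) ^ s * (Real.log (f x) : ℂ) ^ k)) μ := by
  have : Measurable (fun x => (g x : ℂ) * ((f x : ℂ) ^ s * (Real.log (f x) : ℂ) ^ k)) := by
    fun_prop
  exact this.aestronglyMeasurable

lemma Zk_bound {f g : α → ℝ} {B δ : ℝ} (hfB : ∀ᵐ x ∂μ, 0 ≤ f x ∧ f x ≤ B)
    (hgB : ∀ᵐ x ∂μ, |g x| ≤ B) (hB : 1 ≤ B) (hδ : 0 < δ) (k : ℕ) :
    ∀ᵐ x ∂μ, ∀ s : ℂ, δ ≤ s.re → s.re ≤ 3 * δ →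
      ‖(g x : ℂ) * ((f x : ℂ) ^ s * (Real.log (f x) : ℂ) ^ k)‖ ≤
        B * (((k + 1) / δ) ^ k + B ^ (3 * δ) * B ^ k) := by
  filter_upwards [hfB, hgB] with x hx hgx s h1 h2
  rw [norm_mul, norm_real, Real.norm_eq_abs]
  have := norm_ofReal_cpow_le hx.1 hx.2 hB hδ h1 h2 k
  gcongr

lemma Zk_integrable {f g : α → ℝ} {B : ℝ} (hf : Measurable f) (hg : Measurable g)
    (hfB : ∀ᵐ x ∂μ, 0 ≤ f x ∧ f x ≤ B)
    (hgB : ∀ᵐ x ∂μ, |g x| ≤ B) (hB : 1 ≤ B) (k : ℕ) {s : ℂ} (hs : 0 < s.re) :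
    Integrable (fun x => (g x : ℂ) * ((f x : ℂ) ^ s * (Real.log (f x) : ℂ) ^ k)) μ := by
  refine Integrable.of_bound (Zk_aesm μ hf hg k s)
    (B * (((k + 1) / s.re) ^ k + B ^ (3 * s.re) * B ^ k)) ?_
  · filter_upwards [Zk_bound μ hfB hgB hB hs k] with x hx
    exact hx s le_rfl (by linarith)

lemma Zk_hasDerivAt {f g : α → ℝ} {B : ℝ} (hf : Measurable f) (hg : Measurable g)
    (hfB : ∀ᵐ x ∂μ, 0 ≤ f x ∧ f x ≤ B)
    (hgB : ∀ᵐ x ∂μ, |g x| ≤ B) (hB : 1 ≤ B) (k : ℕ) {s : ℂ} (hs : 0 < s.re) :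
    HasDerivAt (Zk μ f g k) (Zk μ f g (k + 1) s) s := by
  have hδ : 0 < s.re / 2 := by linarith
  have hball : ∀ z ∈ Metric.ball s (s.re / 2), s.re / 2 ≤ z.re ∧ z.re ≤ 3 * (s.re / 2) := by
    intro z hz
    have h1 := (abs_re_le_norm (z - s)).trans (mem_ball_iff_norm.1 hz).le
    rw [sub_re, abs_le] at h1
    constructor <;> linarith
  refine (hasDerivAt_integral_of_dominated_loc_of_deriv_le (μ := μ)
    (F' := fun s x => (g x : ℂ) * ((f x : ℂ) ^ s * (Real.log (f x) : ℂ) ^ (k + 1)))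
    (bound := fun _ => B * ((((k + 1 : ℕ) + 1) / (s.re / 2)) ^ (k + 1) +
      B ^ (3 * (s.re / 2)) * B ^ (k + 1)))
    (Metric.ball_mem_nhds s hδ)
    (Eventually.of_forall fun z => Zk_aesm μ hf hg k z)
    (Zk_integrable μ hf hg hfB hgB hB k hs) (Zk_aesm μ hf hg (k + 1) s) ?_
    (integrable_const _) ?_).2
  · filter_upwards [Zk_bound μ hfB hgB hB hδ (k + 1)] with x hx z hz
    exact hx z (hball z hz).1 (hball z hz).2
  · filter_upwards [hfB] with x hx z hz
    have hz0 : z ≠ 0 := by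
      rintro rfl
      have := (hball 0 hz).1
      simp at this; linarith
    have h1 := (hasStrictDerivAt_const_cpow (x := (f x : ℂ)) (y := z) (Or.inr hz0)).hasDerivAt
    have h2 := (h1.mul_const ((Real.log (f x) : ℂ) ^ k)).const_mul (g x : ℂ)
    refine h2.congr_deriv ?_
    rw [ofReal_log hx.1]; ring

lemma Zk_analyticAt {f g : α → ℝ} {B : ℝ} (hf : Measurable f) (hg : Measurable g)
    (hfB : ∀ᵐ x ∂μ, 0 ≤ f x ∧ f x ≤ B)
    (hgB : ∀ᵐ x ∂μ, |g x| ≤ B) (hB : 1 ≤ B) (k : ℕ) {s : ℂ} (hs : 0 < s.re) :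
    AnalyticAt ℂ (Zk μ f g k) s := by
  have ho : IsOpen {z : ℂ | 0 < z.re} := isOpen_lt continuous_const continuous_re
  exact DifferentiableOn.analyticAt (s := {z : ℂ | 0 < z.re})
    (fun z hz => (Zk_hasDerivAt μ hf hg hfB hgB hB k hz).differentiableAt.differentiableWithinAt)
    (ho.mem_nhds hs)

lemma Zk_iteratedDeriv {f g : α → ℝ} {B : ℝ} (hf : Measurable f) (hg : Measurable g)
    (hfB : ∀ᵐ x ∂μ, 0 ≤ f x ∧ f x ≤ B)
    (hgB : ∀ᵐ x ∂μ, |g x| ≤ B) (hB : 1 ≤ B) (k : ℕ) : ∀ {s : ℂ} (hs : 0 < s.re),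
    iteratedDeriv k (Zk μ f g 0) s = Zk μ f g k s := by
  have ho : IsOpen {z : ℂ | 0 < z.re} := isOpen_lt continuous_const continuous_re
  induction k with
  | zero => intro s hs; simp
  | succ k ih =>
    intro s hs
    rw [iteratedDeriv_succ]
    have : iteratedDeriv k (Zk μ f g 0) =ᶠ[nhds s] Zk μ f g k := by
      filter_upwards [ho.mem_nhds hs] with z hz
      exact ih hz
    rw [this.deriv_eq]
    exact (Zk_hasDerivAt μ hf hg hfB hgB hB k hs).deriv

end ZAnalytic


section NiceSec
open Set Filter Topology

def Good (s₀ : ℂ) (g : ℂ → ℂ) : Prop :=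
  AnalyticAt ℂ g s₀ ∧ ∀ k, iteratedDeriv k g s₀ ∈ cubeV

def RatGood (s₀ : ℂ) (g : ℂ → ℂ) : Prop :=
  AnalyticAt ℂ g s₀ ∧ ∀ k, ∃ c : ℚ, iteratedDeriv k g s₀ = c

def Nice (s₀ : ℤ) (I : ℂ → ℂ) : Prop :=
  ∃ (N : ℕ) (g : ℂ → ℂ), Good s₀ g ∧ ∀ᶠ s in 𝓝[≠] (s₀ : ℂ), (s - s₀) ^ N * I s = g s

lemma RatGood.mul_good {s₀ : ℂ} {r g : ℂ → ℂ} (hr : RatGood s₀ r) (hg : Good s₀ g) :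
    Good s₀ (r * g) := by
  refine ⟨hr.1.mul hg.1, fun k => ?_⟩
  rw [iteratedDeriv_mul hr.1.contDiffAt hg.1.contDiffAt]
  refine Submodule.sum_mem _ fun i _ => ?_
  obtain ⟨c, hc⟩ := hr.2 i
  have := cubeV.smul_mem ((k.choose i : ℚ) * c) (hg.2 (k - i))
  rw [hc]
  convert this using 1
  rw [Rat.smul_def]; push_cast; ring

lemma Good.add {s₀ : ℂ} {f g : ℂ → ℂ} (hf : Good s₀ f) (hg : Good s₀ g) : Good s₀ (f + g) := by
  refine ⟨hf.1.add hg.1, fun k => ?_⟩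
  rw [iteratedDeriv_add hf.1.contDiffAt hg.1.contDiffAt]
  exact cubeV.add_mem (hf.2 k) (hg.2 k)

lemma polyC_analytic (p : Polynomial ℚ) (s : ℂ) :
    AnalyticAt ℂ (fun s : ℂ => (Polynomial.aeval s p : ℂ)) s := by
  have : Differentiable ℂ (fun s : ℂ => (Polynomial.aeval s p : ℂ)) := fun s =>
    (p.hasDerivAt_aeval s).differentiableAt
  exact this.analyticAt s

lemma ratfun_iter (p c : Polynomial ℚ) (k : ℕ) : ∃ P : Polynomial ℚ, ∀ s : ℂ,
    (Polynomial.aeval s c : ℂ) ≠ 0 →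
    iteratedDeriv k (fun s : ℂ => (Polynomial.aeval s p : ℂ) / Polynomial.aeval s c) s =
      Polynomial.aeval s P / (Polynomial.aeval s c) ^ (k + 1) := by
  induction k with
  | zero => exact ⟨p, fun s hs => by simp⟩
  | succ k ih =>
    obtain ⟨P, hP⟩ := ih
    refine ⟨Polynomial.derivative P * c - Polynomial.C (k + 1 : ℚ) * P * Polynomial.derivative c, fun s hs => ?_⟩
    have ho : IsOpen {s : ℂ | (Polynomial.aeval s c : ℂ) ≠ 0} :=
      isOpen_ne_fun (continuous_iff_continuousAt.2 fun s => (polyC_analytic c s).continuousAt)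
        continuous_const
    rw [iteratedDeriv_succ]
    have h1 : iteratedDeriv k (fun s : ℂ => (Polynomial.aeval s p : ℂ) / Polynomial.aeval s c)
        =ᶠ[𝓝 s] fun s => Polynomial.aeval s P / (Polynomial.aeval s c) ^ (k + 1) := by
      filter_upwards [ho.mem_nhds hs] with z hz using hP z hz
    rw [h1.deriv_eq]
    have h2 := ((P.hasDerivAt_aeval s).div ((c.hasDerivAt_aeval s).pow (k + 1))
      (pow_ne_zero _ hs)).deriv
    refine Eq.trans h2 ?_
    simp only [map_sub, map_mul, Pi.pow_apply, Nat.add_sub_cancel]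
    simp only [map_add, map_natCast, map_one]
    push_cast
    field_simp
    ring

lemma aeval_int (p : Polynomial ℚ) (s₀ : ℤ) :
    (Polynomial.aeval (s₀ : ℂ) p : ℂ) = ((p.eval (s₀ : ℚ) : ℚ) : ℂ) := by
  have := Polynomial.aeval_algebraMap_apply ℂ (s₀ : ℚ) p
  simpa using this

lemma ratfun_good (p c : Polynomial ℚ) (s₀ : ℤ) (hc : (Polynomial.aeval (s₀ : ℂ) c : ℂ) ≠ 0) :
    RatGood s₀ (fun s : ℂ => (Polynomial.aeval s p : ℂ) / Polynomial.aeval s c) := by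
  refine ⟨(polyC_analytic p _).div (polyC_analytic c _) hc, fun k => ?_⟩
  obtain ⟨P, hP⟩ := ratfun_iter p c k
  refine ⟨P.eval (s₀ : ℚ) / (c.eval (s₀ : ℚ)) ^ (k + 1), ?_⟩
  rw [hP _ hc, aeval_int, aeval_int]
  push_cast; rfl

lemma poly_good (p : Polynomial ℚ) (s₀ : ℤ) :
    RatGood s₀ (fun s : ℂ => (Polynomial.aeval s p : ℂ)) := by
  have := ratfun_good p 1 s₀ (by simp)
  simpa using this

lemma pow_good (s₀ : ℤ) (N : ℕ) : RatGood s₀ (fun s : ℂ => (s - s₀) ^ N) := by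
  have := poly_good ((Polynomial.X - Polynomial.C (s₀ : ℚ)) ^ N) s₀
  simpa using this

lemma Nice.congr {s₀ : ℤ} {I J : ℂ → ℂ} (h : Nice s₀ I) (hJ : ∀ᶠ s in 𝓝[≠] (s₀ : ℂ), I s = J s) :
    Nice s₀ J := by
  obtain ⟨N, g, hg, h⟩ := h
  refine ⟨N, g, hg, ?_⟩
  filter_upwards [h, hJ] with s h1 h2
  rw [← h2, h1]

lemma Good.nice {s₀ : ℤ} {g : ℂ → ℂ} (h : Good s₀ g) : Nice s₀ g :=
  ⟨0, g, h, by simp⟩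

lemma nice_zero (s₀ : ℤ) : Nice s₀ (fun _ => 0) :=
  Good.nice ⟨analyticAt_const, fun k => by
    rw [iteratedDeriv_const]; split_ifs <;> exact cubeV.zero_mem⟩

lemma Nice.add {s₀ : ℤ} {I J : ℂ → ℂ} (hI : Nice s₀ I) (hJ : Nice s₀ J) :
    Nice s₀ (fun s => I s + J s) := by
  obtain ⟨N, g, hg, h⟩ := hI
  obtain ⟨N', g', hg', h'⟩ := hJ
  refine ⟨N + N', _, ((pow_good s₀ N').mul_good hg).add ((pow_good s₀ N).mul_good hg'), ?_⟩
  filter_upwards [h, h'] with s h1 h2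
  simp only [Pi.add_apply, Pi.mul_apply]
  rw [← h1, ← h2]; ring

lemma Nice.ratfun_mul {s₀ : ℤ} {I : ℂ → ℂ} (hI : Nice s₀ I) (p b : Polynomial ℚ) (hb : b ≠ 0) :
    Nice s₀ (fun s => (Polynomial.aeval s p : ℂ) / Polynomial.aeval s b * I s) := by
  obtain ⟨N, g, hg, h⟩ := hI
  obtain ⟨c, hc1, hc2⟩ := Polynomial.exists_eq_pow_rootMultiplicity_mul_and_not_dvd b hb (s₀ : ℚ)
  set M := b.rootMultiplicity (s₀ : ℚ)
  have hc : (Polynomial.aeval (s₀ : ℂ) c : ℂ) ≠ 0 := by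
    rw [aeval_int]
    rw [Polynomial.dvd_iff_isRoot, Polynomial.IsRoot.def] at hc2
    exact_mod_cast hc2
  refine ⟨M + N, _, (ratfun_good p c s₀ hc).mul_good hg, ?_⟩
  have hc' : ∀ᶠ s in 𝓝[≠] (s₀ : ℂ), (Polynomial.aeval s c : ℂ) ≠ 0 :=
    ((polyC_analytic c s₀).continuousAt.eventually_ne hc).filter_mono nhdsWithin_le_nhds
  filter_upwards [h, hc', self_mem_nhdsWithin] with s h1 h2 h3
  have h4 : s - (s₀ : ℂ) ≠ 0 := sub_ne_zero.2 h3
  have h5 : (Polynomial.aeval s b : ℂ) = (s - s₀) ^ M * Polynomial.aeval s c := by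
    conv_lhs => rw [hc1]
    simp
  rw [h5, Pi.mul_apply, ← h1]
  field_simp
  try ring

lemma Nice.poly_mul {s₀ : ℤ} {I : ℂ → ℂ} (hI : Nice s₀ I) (p : Polynomial ℚ) :
    Nice s₀ (fun s => (Polynomial.aeval s p : ℂ) * I s) := by
  have := hI.ratfun_mul p 1 one_ne_zero
  simpa using this

lemma Nice.sum {s₀ : ℤ} {ι : Type*} (t : Finset ι) {I : ι → ℂ → ℂ} (hI : ∀ i ∈ t, Nice s₀ (I i)) :
    Nice s₀ (fun s => ∑ i ∈ t, I i s) := by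
  classical
  induction t using Finset.induction_on with
  | empty => simpa using nice_zero s₀
  | insert a t ha ih =>
    simp only [Finset.sum_insert ha]
    exact (hI a (Finset.mem_insert_self _ _)).add
      (ih fun i hi => hI i (Finset.mem_insert_of_mem hi))

lemma tendsto_shift (s₀ : ℂ) (j : ℂ) : Tendsto (fun s : ℂ => s + j) (𝓝[≠] s₀) (𝓝[≠] (s₀ + j)) := by
  refine tendsto_nhdsWithin_iff.2 ⟨?_, ?_⟩
  · exact ((continuous_id.add continuous_const).tendsto s₀).mono_left nhdsWithin_le_nhds
  · filter_upwards [self_mem_nhdsWithin] with s hs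
    simpa using hs

lemma Nice.shift {s₀ : ℤ} {I : ℂ → ℂ} (j : ℤ) (hI : Nice (s₀ + j) I) :
    Nice s₀ (fun s => I (s + j)) := by
  obtain ⟨N, g, hg, h⟩ := hI
  push_cast at hg h
  refine ⟨N, fun s => g (s + j), ⟨?_, fun k => ?_⟩, ?_⟩
  · exact AnalyticAt.fun_comp hg.1 (by fun_prop)
  · rw [iteratedDeriv_comp_add_const]; exact hg.2 k
  · filter_upwards [(tendsto_shift s₀ j).eventually h] with s hs
    rw [← hs]; ring

lemma Nice.laurent {s₀ : ℤ} {I : ℂ → ℂ} (hI : Nice s₀ I) : ∃ (N : ℤ) (a : ℕ → ℂ),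
    (∀ i, IsPeriod (a i)) ∧ ∀ᶠ s in 𝓝[≠] (s₀ : ℂ),
      I s = ∑' i : ℕ, a i * (s - (s₀ : ℂ)) ^ (N + i) := by
  obtain ⟨N, g, hg, h⟩ := hI
  refine ⟨-N, fun i => iteratedDeriv i g s₀ / (i.factorial : ℂ), fun i => cubeV_isPeriod ?_, ?_⟩
  · have := cubeV.smul_mem ((i.factorial : ℚ)⁻¹) (hg.2 i)
    convert this using 1
    rw [Rat.smul_def]; push_cast; rw [div_eq_inv_mul]
  · have h2 := (hg.1.hasFPowerSeriesAt.eventually_hasSum_sub).filter_mono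
      (nhdsWithin_le_nhds (s := {(s₀ : ℂ)}ᶜ))
    filter_upwards [h, h2, self_mem_nhdsWithin] with s h1 h2 h3
    have h4 : s - (s₀ : ℂ) ≠ 0 := sub_ne_zero.2 h3
    have h5 : I s = (s - s₀) ^ (-(N : ℤ)) * g s := by
      rw [← h1, zpow_neg, zpow_natCast]; field_simp
    rw [h5, ← h2.tsum_eq, ← tsum_mul_left]
    congr 1
    ext i
    rw [zpow_add₀ h4, FormalMultilinearSeries.ofScalars_apply_eq, zpow_natCast]
    simp
    ring

end NiceSec


section CubeZeta
open MvPolynomial Set Filter Topology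

/-- real evaluation cast to complex numbers -/
def ev {n : ℕ} (x : Fin n → ℝ) (p : MvPolynomial (Fin n) ℚ) : ℂ := ((aeval x p : ℝ) : ℂ)

def CubeNonneg {n : ℕ} (F : MvPolynomial (Fin n) ℚ) : Prop :=
  ∀ x : Fin n → ℝ, (∀ i, x i ∈ Icc (0:ℝ) 1) → 0 ≤ (aeval x F : ℝ)

def Zc {n : ℕ} (F G : MvPolynomial (Fin n) ℚ) (s : ℂ) : ℂ :=
  ∫ x, ev x G * ev x F ^ s ∂(cubeM (Fin n))

lemma aeval_cont {n : ℕ} (p : MvPolynomial (Fin n) ℚ) :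
    Continuous fun z : Fin n → ℝ => (aeval z p : ℝ) := by
  simp only [aeval_def, ← eval_map]
  exact continuous_eval _

lemma cubeM_ae' (n : ℕ) : ∀ᵐ x ∂(cubeM (Fin n)), ∀ i, x i ∈ Icc (0:ℝ) 1 := by
  filter_upwards [cubeM_ae (Fin n)] with x hx i using Ioo_subset_Icc_self (hx i)

lemma cube_compact (n : ℕ) : IsCompact {x : Fin n → ℝ | ∀ i, x i ∈ Icc (0:ℝ) 1} := by
  have := isCompact_univ_pi (fun _ : Fin n => isCompact_Icc (a := (0:ℝ)) (b := 1))
  convert this using 1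
  ext x; simp only [mem_setOf_eq, Set.mem_pi, mem_univ, true_implies]

lemma cube_bound {n : ℕ} (F G : MvPolynomial (Fin n) ℚ) : ∃ B : ℝ, 1 ≤ B ∧
    ∀ x : Fin n → ℝ, (∀ i, x i ∈ Icc (0:ℝ) 1) → |(aeval x F : ℝ)| ≤ B ∧ |(aeval x G : ℝ)| ≤ B := by
  obtain ⟨B1, h1⟩ := (cube_compact n).exists_bound_of_continuousOn (aeval_cont F).continuousOn
  obtain ⟨B2, h2⟩ := (cube_compact n).exists_bound_of_continuousOn (aeval_cont G).continuousOn
  refine ⟨max 1 (max B1 B2), le_max_left _ _, fun x hx => ⟨?_, ?_⟩⟩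
  · exact (h1 x hx).trans ((le_max_left _ _).trans (le_max_right _ _))
  · exact (h2 x hx).trans ((le_max_right _ _).trans (le_max_right _ _))

lemma Zc_eq {n : ℕ} (F G : MvPolynomial (Fin n) ℚ) :
    Zc F G = Zk (cubeM (Fin n)) (fun x => (aeval x F : ℝ)) (fun x => (aeval x G : ℝ)) 0 := by
  ext s; simp [Zc, Zk, ev]

lemma cube_hyp {n : ℕ} {F : MvPolynomial (Fin n) ℚ} (hF : CubeNonneg F) (G : MvPolynomial (Fin n) ℚ) :
    ∃ B : ℝ, 1 ≤ B ∧ (∀ᵐ x ∂(cubeM (Fin n)), 0 ≤ (aeval x F : ℝ) ∧ (aeval x F : ℝ) ≤ B) ∧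
      ∀ᵐ x ∂(cubeM (Fin n)), |(aeval x G : ℝ)| ≤ B := by
  obtain ⟨B, hB, h⟩ := cube_bound F G
  refine ⟨B, hB, ?_, ?_⟩
  · filter_upwards [cubeM_ae' n] with x hx using ⟨hF x hx, (abs_le.1 (h x hx).1).2⟩
  · filter_upwards [cubeM_ae' n] with x hx using (h x hx).2

lemma Zc_integrable {n : ℕ} {F : MvPolynomial (Fin n) ℚ} (hF : CubeNonneg F)
    (G : MvPolynomial (Fin n) ℚ) {s : ℂ} (hs : 0 < s.re) :
    Integrable (fun x => ev x G * ev x F ^ s) (cubeM (Fin n)) := by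
  obtain ⟨B, hB, h1, h2⟩ := cube_hyp hF G
  have := Zk_integrable (cubeM (Fin n)) (aeval_cont F).measurable (aeval_cont G).measurable h1 h2 hB 0 hs
  simpa [ev] using this

lemma Zc_analyticAt {n : ℕ} {F : MvPolynomial (Fin n) ℚ} (hF : CubeNonneg F)
    (G : MvPolynomial (Fin n) ℚ) {s : ℂ} (hs : 0 < s.re) : AnalyticAt ℂ (Zc F G) s := by
  obtain ⟨B, hB, h1, h2⟩ := cube_hyp hF G
  rw [Zc_eq]
  exact Zk_analyticAt (cubeM (Fin n)) (aeval_cont F).measurable (aeval_cont G).measurable h1 h2 hB 0 hs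

lemma Zc_good {n : ℕ} {F : MvPolynomial (Fin n) ℚ} (hF : CubeNonneg F)
    (G : MvPolynomial (Fin n) ℚ) {s : ℤ} (hs : 0 < s) : Good s (Zc F G) := by
  obtain ⟨B, hB, h1, h2⟩ := cube_hyp hF G
  have hs' : 0 < ((s : ℂ)).re := by simpa using hs
  refine ⟨Zc_analyticAt hF G hs', fun k => ?_⟩
  rw [Zc_eq, Zk_iteratedDeriv (cubeM (Fin n)) (aeval_cont F).measurable (aeval_cont G).measurable
    h1 h2 hB k hs']
  obtain ⟨N, rfl⟩ := Int.eq_ofNat_of_zero_le hs.le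
  have hN : N ≠ 0 := by rintro rfl; simp at hs
  have hi := Zk_integrable (cubeM (Fin n)) (aeval_cont F).measurable (aeval_cont G).measurable
    h1 h2 hB k hs'
  have e : ∀ x : Fin n → ℝ, ((aeval x G : ℝ) : ℂ) * (((aeval x F : ℝ) : ℂ) ^ (((N : ℕ) : ℤ) : ℂ) *
      (Real.log (aeval x F) : ℂ) ^ k) = (((aeval x G : ℝ) * (aeval x F : ℝ) ^ N *
      (Real.log (aeval x F)) ^ k : ℝ) : ℂ) := by
    intro x
    rw [Int.cast_natCast, cpow_natCast]
    push_cast; ring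
  simp only [e] at hi
  refine ⟨_, log_pow_period F G (fun x hx => hF x fun i => Ioo_subset_Icc_self (hx i)) N k hN ?_, ?_⟩
  · have := hi.re
    simpa only [RCLike.re_to_complex, ofReal_re] using this
  · rw [Zk]
    simp only [e]
    exact integral_ofReal

end CubeZeta


section Parts
open MvPolynomial Set Filter Topology

def face {n : ℕ} (i : Fin (n + 1)) (c : ℚ) (p : MvPolynomial (Fin (n + 1)) ℚ) :
    MvPolynomial (Fin n) ℚ :=
  aeval (Fin.insertNth (α := fun _ => MvPolynomial (Fin n) ℚ) i (C c) X) p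

lemma aeval_face {n : ℕ} (i : Fin (n + 1)) (c : ℚ) (p : MvPolynomial (Fin (n + 1)) ℚ)
    (y : Fin n → ℝ) :
    (aeval y (face i c p) : ℝ) = aeval (Fin.insertNth (α := fun _ => ℝ) i (c : ℝ) y) p := by
  unfold face
  rw [← AlgHom.comp_apply, comp_aeval]
  congr 2
  ext j
  rcases Fin.eq_self_or_eq_succAbove i j with h | ⟨k, h⟩
  · subst h; simp
  · subst h; simp

lemma cube_insert {n : ℕ} (i : Fin (n + 1)) {t : ℝ} {y : Fin n → ℝ} (ht : t ∈ Icc (0:ℝ) 1)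
    (hy : ∀ j, y j ∈ Icc (0:ℝ) 1) (j : Fin (n + 1)) :
    Fin.insertNth (α := fun _ => ℝ) i t y j ∈ Icc (0:ℝ) 1 := by
  rcases Fin.eq_self_or_eq_succAbove i j with h | ⟨k, h⟩
  · subst h; simpa using ht
  · subst h; simpa using hy k

lemma face_nonneg {n : ℕ} (i : Fin (n + 1)) {c : ℚ} (hc : (c : ℝ) ∈ Icc (0:ℝ) 1)
    {F : MvPolynomial (Fin (n + 1)) ℚ} (hF : CubeNonneg F) : CubeNonneg (face i c F) := by
  intro y hy
  rw [aeval_face]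
  exact hF _ (cube_insert i hc hy)

lemma hasDerivAt_insert {n : ℕ} (i : Fin (n + 1)) (y : Fin n → ℝ)
    (p : MvPolynomial (Fin (n + 1)) ℚ) (t : ℝ) :
    HasDerivAt (fun t : ℝ => (aeval (Fin.insertNth (α := fun _ => ℝ) i t y) p : ℝ))
      (aeval (Fin.insertNth (α := fun _ => ℝ) i t y) (pderiv i p)) t := by
  induction p using MvPolynomial.induction_on with
  | C a => simpa using hasDerivAt_const t (a : ℝ)
  | add p q hp hq => simp only [map_add]; exact hp.add hq
  | mul_X p j hp =>
    have hj : HasDerivAt (fun t : ℝ => Fin.insertNth (α := fun _ => ℝ) i t y j)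
        (aeval (Fin.insertNth (α := fun _ => ℝ) i t y) (pderiv i (X j : MvPolynomial (Fin (n+1)) ℚ))) t := by
      rcases Fin.eq_self_or_eq_succAbove i j with h | ⟨k, h⟩
      · subst h; simp only [Fin.insertNth_apply_same, pderiv_X_self, map_one]; exact hasDerivAt_id' t
      · subst h
        simpa [pderiv_X, Fin.succAbove_ne] using hasDerivAt_const t (y k)
    have := hp.mul hj
    simp only [map_mul, aeval_X]
    refine this.congr_deriv ?_
    simp only [Derivation.leibniz, smul_eq_mul, map_add, map_mul, aeval_X]
    ring

/-- derivative of `F ^ s` at any point where `F ≥ 0` -/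
lemma hasDerivAt_cpow_nonneg {f : ℝ → ℝ} {f' t : ℝ} (hf : HasDerivAt f f' t) (h0 : 0 ≤ f t)
    {s : ℂ} (hs : 1 < s.re) :
    HasDerivAt (fun t => (f t : ℂ) ^ s) (s * (f t : ℂ) ^ (s - 1) * f') t := by
  rcases h0.eq_or_lt with h | h
  · have hs1 : 0 < (s - 1).re := by simp; linarith
    have hs0 : s ≠ 0 := by rintro rfl; simp at hs; linarith
    have hs10 : s - 1 ≠ 0 := by intro h; rw [h] at hs1; simp at hs1
    have e1 : ∀ y : ℂ, y ^ s = y * y ^ (s - 1) := by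
      intro y
      by_cases hy : y = 0
      · rw [hy, zero_cpow hs0, zero_mul]
      · conv_lhs => rw [show s = 1 + (s - 1) by ring, cpow_add _ _ hy, cpow_one]
    rw [← h, ofReal_zero, zero_cpow hs10, mul_zero, zero_mul, hasDerivAt_iff_isLittleO]
    simp only [← h, ofReal_zero, zero_cpow hs0, smul_zero, sub_zero]
    have hO : (fun u => (f u : ℂ)) =O[𝓝 t] fun u => u - t := by
      have := hf.isBigO_sub
      rw [← h] at this
      simp only [sub_zero] at this
      refine Asymptotics.IsBigO.trans ?_ this
      exact Asymptotics.isBigO_of_le _ fun u => by simp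
    have ho : (fun u => (f u : ℂ) ^ (s - 1)) =o[𝓝 t] fun _ => (1 : ℝ) := by
      rw [Asymptotics.isLittleO_one_iff]
      have h1 : ContinuousAt (fun z : ℂ => z ^ (s - 1)) (f t : ℂ) :=
        continuousAt_cpow_const_of_re_pos (Or.inl (by simp [← h])) hs1
      have h2 : ContinuousAt (fun u => (f u : ℂ)) t :=
        continuous_ofReal.continuousAt.comp hf.continuousAt
      have h3 : ContinuousAt (fun u => (f u : ℂ) ^ (s - 1)) t := ContinuousAt.comp (f := fun u => (f u : ℂ)) h1 h2
      have := h3.tendsto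
      rwa [← h, ofReal_zero, zero_cpow hs10] at this
    have := hO.mul_isLittleO ho
    simpa only [← e1, mul_one] using this
  · have h1 : HasDerivAt (fun z : ℂ => z ^ s) (s * (f t : ℂ) ^ (s - 1) * 1) (f t : ℂ) :=
      (hasDerivAt_id' (f t : ℂ)).cpow_const (Or.inl (by simpa using h))
    rw [mul_one] at h1
    exact HasDerivAt.comp t (h₂ := fun z : ℂ => z ^ s) h1 hf.ofReal_comp

/-- integrand of the boundary term -/
def bdI {n : ℕ} (i : Fin n) (F h : MvPolynomial (Fin n) ℚ) (s : ℂ) (x : Fin n → ℝ) : ℂ :=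
  (ev x (pderiv i h) * ev x F + s * ev x h * ev x (pderiv i F)) * ev x F ^ (s - 1)

lemma cpow_cont {n : ℕ} {F : MvPolynomial (Fin n) ℚ} {x : Fin n → ℝ} (h0 : 0 ≤ (aeval x F : ℝ))
    {s : ℂ} (hs : 0 < s.re) : ContinuousAt (fun x => ev x F ^ s) x := by
  have h1 : ContinuousAt (fun z : ℂ => z ^ s) (ev x F) :=
    continuousAt_cpow_const_of_re_pos (Or.inl (by simpa [ev] using h0)) hs
  exact ContinuousAt.comp (f := fun u => ev u F) h1
    (continuous_ofReal.comp (aeval_cont F)).continuousAt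

lemma bdI_contOn {n : ℕ} (i : Fin n) {F : MvPolynomial (Fin n) ℚ} (hF : CubeNonneg F)
    (h : MvPolynomial (Fin n) ℚ) {s : ℂ} (hs : 1 < s.re) :
    ContinuousOn (bdI i F h s) {x | ∀ i, x i ∈ Icc (0:ℝ) 1} := by
  intro x hx
  refine ContinuousAt.continuousWithinAt ?_
  have hc : ∀ p : MvPolynomial (Fin n) ℚ, ContinuousAt (fun x => ev x p) x := fun p =>
    (continuous_ofReal.comp (aeval_cont p)).continuousAt
  exact (((hc _).mul (hc _)).add ((continuousAt_const.mul (hc _)).mul (hc _))).mul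
    (cpow_cont (hF x hx) (by simpa using hs))

lemma integrable_of_contOn {n : ℕ} {φ : (Fin n → ℝ) → ℂ}
    (h : ContinuousOn φ {x | ∀ i, x i ∈ Icc (0:ℝ) 1}) : Integrable φ (cubeM (Fin n)) := by
  rw [cubeM_eq]
  refine (h.integrableOn_compact (cube_compact n)).mono_set ?_
  intro x hx i
  exact Ioo_subset_Icc_self (hx i (mem_univ i))

lemma bdI_integral {n : ℕ} (i : Fin (n + 1)) {F : MvPolynomial (Fin (n + 1)) ℚ} (hF : CubeNonneg F)
    (h : MvPolynomial (Fin (n + 1)) ℚ) {s : ℂ} (hs : 1 < s.re) :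
    ∫ x, bdI i F h s x ∂(cubeM (Fin (n + 1))) =
      Zc (face i 1 F) (face i 1 h) s - Zc (face i 0 F) (face i 0 h) s := by
  have hmp : MeasurePreserving (MeasurableEquiv.piFinSuccAbove (fun _ : Fin (n+1) => ℝ) i)
      (cubeM (Fin (n + 1))) (((volume : Measure ℝ).restrict (Ioo 0 1)).prod (cubeM (Fin n))) :=
    measurePreserving_piFinSuccAbove (fun _ => (volume : Measure ℝ).restrict (Ioo 0 1)) i
  have hmp' := hmp.symm
  have hint := integrable_of_contOn (bdI_contOn i hF h hs)
  have hs0 : 0 < s.re := by linarith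
  have hprod := hmp'.integrable_comp_of_integrable hint
  rw [← hmp'.integral_comp (MeasurableEquiv.measurableEmbedding _)]
  have hprod' : Integrable (fun z : ℝ × (Fin n → ℝ) => bdI i F h s (Fin.insertNth (α := fun _ => ℝ) i z.1 z.2))
      (((volume : Measure ℝ).restrict (Ioo 0 1)).prod (cubeM (Fin n))) := hprod
  have e0 : ∀ z : ℝ × (Fin n → ℝ), (MeasurableEquiv.piFinSuccAbove (fun _ : Fin (n+1) => ℝ) i).symm z
    = Fin.insertNth (α := fun _ => ℝ) i z.1 z.2 := fun z => rfl
  simp only [e0]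
  rw [integral_prod_symm _ hprod', Zc, Zc, ← integral_sub
    (Zc_integrable (face_nonneg i (by simp) hF) _ hs0) (Zc_integrable (face_nonneg i (by simp) hF) _ hs0)]
  refine integral_congr_ae ?_
  filter_upwards [cubeM_ae' n] with y hy
  have hder : ∀ t ∈ uIcc (0:ℝ) 1, HasDerivAt (fun t : ℝ =>
      ev (Fin.insertNth (α := fun _ => ℝ) i t y) h * ev (Fin.insertNth (α := fun _ => ℝ) i t y) F ^ s)
      (bdI i F h s (Fin.insertNth (α := fun _ => ℝ) i t y)) t := by
    intro t ht
    rw [uIcc_of_le zero_le_one] at ht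
    have h1 := (hasDerivAt_insert i y h t).ofReal_comp
    have h2 := hasDerivAt_cpow_nonneg (hasDerivAt_insert i y F t) (hF _ (cube_insert i ht hy)) hs
    refine (h1.mul h2).congr_deriv ?_
    unfold bdI ev
    have e1 : ((aeval (Fin.insertNth (α := fun _ => ℝ) i t y) F : ℝ) : ℂ) ^ s =
      ((aeval (Fin.insertNth (α := fun _ => ℝ) i t y) F : ℝ) : ℂ) *
      ((aeval (Fin.insertNth (α := fun _ => ℝ) i t y) F : ℝ) : ℂ) ^ (s - 1) := by
      generalize ((aeval (Fin.insertNth (α := fun _ => ℝ) i t y) F : ℝ) : ℂ) = w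
      have hs0 : s ≠ 0 := by rintro rfl; simp at hs; linarith
      by_cases hw : w = 0
      · rw [hw, zero_cpow hs0, zero_mul]
      · conv_lhs => rw [show s = 1 + (s - 1) by ring, cpow_add _ _ hw, cpow_one]
    rw [e1]; ring
  have hcont : ContinuousOn (fun t : ℝ => bdI i F h s (Fin.insertNth (α := fun _ => ℝ) i t y)) (uIcc 0 1) := by
    rw [uIcc_of_le zero_le_one]
    refine ContinuousOn.comp (f := fun t : ℝ => Fin.insertNth (α := fun _ => ℝ) i t y)
      (bdI_contOn i hF h hs) ?_ (fun t ht => cube_insert i ht hy)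
    refine Continuous.continuousOn (continuous_pi fun j => ?_)
    rcases Fin.eq_self_or_eq_succAbove i j with h | ⟨k, h⟩
    · subst h; simpa using continuous_id'
    · subst h; simpa using continuous_const
  have := intervalIntegral.integral_eq_sub_of_hasDerivAt hder hcont.intervalIntegrable
  rw [intervalIntegral.integral_of_le zero_le_one, integral_Ioc_eq_integral_Ioo] at this
  rw [this]
  simp only [ev, aeval_face]
  simp

end Parts


section Step
open MvPolynomial Set Filter Topology

def evs {n : ℕ} (w : ℂ) (x : Fin n → ℝ) : MvPolynomial (Fin n) (Polynomial ℚ) →+* ℂ :=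
  eval₂Hom (Polynomial.aeval w : Polynomial ℚ →ₐ[ℚ] ℂ).toRingHom (fun i => (x i : ℂ))

lemma evs_C {n : ℕ} (w : ℂ) (x : Fin n → ℝ) (b : Polynomial ℚ) :
    evs w x (C b) = Polynomial.aeval w b := by
  simp [evs]

lemma evs_map {n : ℕ} (w : ℂ) (x : Fin n → ℝ) (p : MvPolynomial (Fin n) ℚ) :
    evs w x (map Polynomial.C p) = ev x p := by
  have h1 : evs w x (map Polynomial.C p) = aeval (fun i => (x i : ℂ)) p := by
    simp only [evs, coe_eval₂Hom, eval₂_map, aeval_def]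
    congr 1
    exact RingHom.ext fun r => by simp
  rw [h1, ev]
  have := map_aeval x ofRealHom p
  simp only [ofRealHom_eq_coe] at this
  rw [this]
  simp only [aeval_def, coe_eval₂Hom]
  congr 1

lemma poly_decomp {n : ℕ} (p : MvPolynomial (Fin n) (Polynomial ℚ)) :
    p = ∑ γ ∈ p.support, C (coeff γ p) * map Polynomial.C (monomial γ (1:ℚ)) := by
  conv_lhs => rw [p.as_sum]
  refine Finset.sum_congr rfl fun γ _ => ?_
  rw [map_monomial, C_mul_monomial]; simp

lemma evs_sum {n : ℕ} (w : ℂ) (x : Fin n → ℝ) (p : MvPolynomial (Fin n) (Polynomial ℚ)) :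
    evs w x p = ∑ γ ∈ p.support, Polynomial.aeval w (coeff γ p) * ev x (monomial γ (1:ℚ)) := by
  conv_lhs => rw [poly_decomp p]
  rw [map_sum]
  refine Finset.sum_congr rfl fun γ _ => ?_
  rw [map_mul, evs_C, evs_map]

lemma evs_pderiv {n : ℕ} (w : ℂ) (x : Fin n → ℝ) (i : Fin n)
    (p : MvPolynomial (Fin n) (Polynomial ℚ)) :
    evs w x (pderiv i p) =
      ∑ γ ∈ p.support, Polynomial.aeval w (coeff γ p) * ev x (pderiv i (monomial γ (1:ℚ))) := by
  conv_lhs => rw [poly_decomp p]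
  rw [map_sum, map_sum]
  refine Finset.sum_congr rfl fun γ _ => ?_
  rw [pderiv_C_mul, pderiv_map, map_mul, evs_C, evs_map]

lemma pow_mul_cpow (φ : ℂ) (k : ℕ) {z : ℂ} (hz : 0 < z.re) : φ ^ k * φ ^ z = φ ^ (z + k) := by
  by_cases h : φ = 0
  · have h1 : z ≠ 0 := by rintro rfl; simp at hz
    have h2 : z + k ≠ 0 := by
      intro h
      have := congrArg re h
      simp at this
      have h3 : (0:ℝ) ≤ k := Nat.cast_nonneg k
      linarith
    rw [h, zero_cpow h1, zero_cpow h2, mul_zero]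
  · rw [cpow_add _ _ h, cpow_natCast, mul_comm]

lemma step_pointwise {n : ℕ} {F G : MvPolynomial (Fin n) ℚ} {b : Polynomial ℚ} {m L : ℕ}
    {q : MvPolynomial (Fin n) (Polynomial ℚ)} {h : Fin n → MvPolynomial (Fin n) (Polynomial ℚ)}
    (key : C b * map Polynomial.C G * (map Polynomial.C F) ^ (m + L + 1) =
      q * (map Polynomial.C F) ^ (m + L + 2) + ∑ i, (map Polynomial.C F * pderiv i (h i) +
        C (Polynomial.X - Polynomial.C (L : ℚ)) * h i * pderiv i (map Polynomial.C F)))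
    (x : Fin n → ℝ) {w : ℂ} (hw : L + 1 < w.re) :
    Polynomial.aeval w b * (ev x G * ev x F ^ (w + m)) =
      ∑ γ ∈ q.support, Polynomial.aeval w (coeff γ q) *
          (ev x (monomial γ (1:ℚ)) * ev x F ^ (w + m + 1)) +
        ∑ i, ∑ γ ∈ (h i).support, Polynomial.aeval w (coeff γ (h i)) *
          bdI i F (monomial γ (1:ℚ)) (w - L) x := by
  have hz : 0 < (w - L - 1).re := by simp; linarith
  have k1 := congrArg (fun P => evs w x P * ev x F ^ (w - L - 1)) key
  simp only [map_add, map_mul, map_pow, map_sum, pderiv_map, evs_C, evs_map, evs_pderiv] at k1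
  rw [mul_assoc, pow_mul_cpow _ _ hz, add_mul, mul_assoc (evs w x q), pow_mul_cpow _ _ hz] at k1
  have e1 : w - L - 1 + ((m + L + 1 : ℕ) : ℂ) = w + m := by push_cast; ring
  have e2 : w - L - 1 + ((m + L + 2 : ℕ) : ℂ) = w + m + 1 := by push_cast; ring
  rw [e1, e2] at k1
  rw [← mul_assoc, k1, evs_sum, Finset.sum_mul, Finset.sum_mul]
  congr 1
  · exact Finset.sum_congr rfl fun γ _ => by ring
  · refine Finset.sum_congr rfl fun i _ => ?_
    rw [evs_sum]
    simp only [bdI, map_sub, Polynomial.aeval_X, Polynomial.aeval_C, Finset.mul_sum, Finset.sum_mul,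
      ← Finset.sum_add_distrib]
    refine Finset.sum_congr rfl fun γ _ => ?_
    simp
    ring

lemma step_integral {n : ℕ} {F G : MvPolynomial (Fin n) ℚ} {b : Polynomial ℚ} {m L : ℕ}
    {q : MvPolynomial (Fin n) (Polynomial ℚ)} {h : Fin n → MvPolynomial (Fin n) (Polynomial ℚ)}
    (hF : CubeNonneg F)
    (key : C b * map Polynomial.C G * (map Polynomial.C F) ^ (m + L + 1) =
      q * (map Polynomial.C F) ^ (m + L + 2) + ∑ i, (map Polynomial.C F * pderiv i (h i) +
        C (Polynomial.X - Polynomial.C (L : ℚ)) * h i * pderiv i (map Polynomial.C F)))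
    {w : ℂ} (hw : L + 1 < w.re) :
    Polynomial.aeval w b * Zc F G (w + m) =
      ∑ γ ∈ q.support, Polynomial.aeval w (coeff γ q) * Zc F (monomial γ (1:ℚ)) (w + m + 1) +
        ∑ i, ∑ γ ∈ (h i).support, Polynomial.aeval w (coeff γ (h i)) *
          ∫ x, bdI i F (monomial γ (1:ℚ)) (w - L) x ∂(cubeM (Fin n)) := by
  have hm : (0:ℝ) ≤ m := Nat.cast_nonneg m
  have hL : (0:ℝ) ≤ L := Nat.cast_nonneg L
  have hb : ∀ i (p : MvPolynomial (Fin n) ℚ), Integrable (bdI i F p (w - L)) (cubeM (Fin n)) :=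
    fun i p => integrable_of_contOn (bdI_contOn i hF p (by simp; linarith))
  have hz : ∀ p : MvPolynomial (Fin n) ℚ,
      Integrable (fun x => ev x p * ev x F ^ (w + m + 1)) (cubeM (Fin n)) :=
    fun p => Zc_integrable hF p (by simp; linarith)
  unfold Zc
  simp only [← integral_const_mul]
  simp only [step_pointwise key _ hw]
  rw [integral_add (integrable_finsetSum _ fun γ _ => (hz _).const_mul _)
    (integrable_finsetSum _ fun i _ => integrable_finsetSum _ fun γ _ => (hb i _).const_mul _),
    integral_finsetSum _ fun γ _ => (hz _).const_mul _,
    integral_finsetSum _ fun i _ => integrable_finsetSum _ fun γ _ => (hb i _).const_mul _]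
  congr 1
  refine Finset.sum_congr rfl fun i _ => ?_
  rw [integral_finsetSum _ fun γ _ => (hb i _).const_mul _]

end Step


section Cont
open MvPolynomial Set Filter Topology

def OK (M : ℤ) (I : ℂ → ℂ) : Prop :=
  (∀ s : ℂ, -(M:ℝ) < s.re → MeromorphicAt I s) ∧ ∀ s₀ : ℤ, -M < s₀ → Nice s₀ I

lemma OK.add {M : ℤ} {I J : ℂ → ℂ} (hI : OK M I) (hJ : OK M J) : OK M (fun s => I s + J s) :=
  ⟨fun s hs => (hI.1 s hs).add (hJ.1 s hs), fun s hs => (hI.2 s hs).add (hJ.2 s hs)⟩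

lemma OK.sum {M : ℤ} {ι : Type*} (t : Finset ι) {I : ι → ℂ → ℂ} (hI : ∀ i ∈ t, OK M (I i)) :
    OK M (fun s => ∑ i ∈ t, I i s) :=
  ⟨fun s hs => MeromorphicAt.fun_sum fun i hi => (hI i hi).1 s hs,
    fun s hs => Nice.sum t fun i hi => (hI i hi).2 s hs⟩

lemma OK.ratfun_mul {M : ℤ} {I : ℂ → ℂ} (hI : OK M I) (p b : Polynomial ℚ) (hb : b ≠ 0) :
    OK M (fun s => (Polynomial.aeval s p : ℂ) / Polynomial.aeval s b * I s) :=
  ⟨fun s hs => ((polyC_analytic p s).meromorphicAt.div (polyC_analytic b s).meromorphicAt).mul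
    (hI.1 s hs), fun s hs => (hI.2 s hs).ratfun_mul p b hb⟩

lemma OK.shift {M : ℤ} {I : ℂ → ℂ} (hI : OK M I) (j : ℤ) : OK (M + j) (fun s => I (s + j)) := by
  refine ⟨fun s hs => ?_, fun s hs => Nice.shift j (hI.2 _ (by lia))⟩
  have h1 : MeromorphicAt I (s + j) := hI.1 _ (by simp; push_cast at hs; linarith)
  exact MeromorphicAt.comp_analyticAt (f := I) (g := fun s => s + (j:ℂ)) h1 (by fun_prop)

lemma OK.mono {M M' : ℤ} {I : ℂ → ℂ} (hI : OK M I) (h : M' ≤ M) : OK M' I := by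
  have h' : (M':ℝ) ≤ M := by exact_mod_cast h
  exact ⟨fun s hs => hI.1 s (by linarith), fun s hs => hI.2 s (by lia)⟩

abbrev farR : Filter ℂ := comap re atTop

lemma farR_gt (c : ℝ) : ∀ᶠ s in farR, c < s.re := (eventually_gt_atTop c).comap re

lemma farR_shift (j : ℂ) : Tendsto (fun s : ℂ => s + j) farR farR := by
  rw [tendsto_comap_iff]
  have : (re ∘ fun s : ℂ => s + j) = fun s => re s + re j := by ext; simp
  rw [this]
  exact tendsto_atTop_add_const_right _ _ tendsto_comap

lemma farR_poly (b : Polynomial ℚ) (hb : b ≠ 0) :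
    ∀ᶠ s in farR, (Polynomial.aeval s b : ℂ) ≠ 0 := by
  have hb' : b.map (algebraMap ℚ ℂ) ≠ 0 := by
    rwa [Ne, Polynomial.map_eq_zero]
  have : ∀ᶠ s in farR, ∀ z ∈ (b.map (algebraMap ℚ ℂ)).roots.toFinset, s ≠ z := by
    rw [Filter.eventually_all_finset]
    intro z _
    filter_upwards [farR_gt z.re] with s hs h
    rw [h] at hs; exact lt_irrefl _ hs
  filter_upwards [this] with s hs h
  refine hs s ?_ rfl
  rw [Multiset.mem_toFinset, Polynomial.mem_roots hb', Polynomial.IsRoot.def,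
    Polynomial.eval_map_algebraMap]
  exact h

lemma comp_ne {b : Polynomial ℚ} (hb : b ≠ 0) (m : ℚ) :
    b.comp (Polynomial.X - Polynomial.C m) ≠ 0 := by
  intro h
  rw [Polynomial.comp_eq_zero_iff] at h
  rcases h with h | ⟨_, h⟩
  · exact hb h
  · have := congrArg Polynomial.natDegree h
    simp at this

lemma aeval_comp_sub (b : Polynomial ℚ) (m : ℕ) (s : ℂ) :
    (Polynomial.aeval s (b.comp (Polynomial.X - Polynomial.C (m:ℚ))) : ℂ) =
      Polynomial.aeval (s - m) b := by
  rw [Polynomial.aeval_comp]; simp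

/-- the boundary terms continue -/
def HB {n : ℕ} (F : MvPolynomial (Fin n) ℚ) : Prop :=
  ∀ (i : Fin n) (h : MvPolynomial (Fin n) ℚ), ∃ B : ℂ → ℂ, (∀ M, OK M B) ∧
    ∀ s : ℂ, 1 < s.re → B s = ∫ x, bdI i F h s x ∂(cubeM (Fin n))

lemma cont_step {n : ℕ} {F : MvPolynomial (Fin n) ℚ} (hF : CubeNonneg F) (hF0 : F ≠ 0) (hB : HB F)
    (M : ℤ) (ih : ∀ G, ∃ I, OK M I ∧ ∀ᶠ s in farR, I s = Zc F G s)
    (G : MvPolynomial (Fin n) ℚ) : ∃ I, OK (M + 1) I ∧ ∀ᶠ s in farR, I s = Zc F G s := by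
  obtain ⟨b, m, L, q, h, hb, key⟩ := bs_key F G hF0
  choose J hJ hJ' using ih
  choose B hB1 hB2 using hB
  set S : Polynomial ℚ → Polynomial ℚ := fun p => p.comp (Polynomial.X - Polynomial.C (m:ℚ)) with hS
  refine ⟨fun s =>
    ∑ γ ∈ q.support, (Polynomial.aeval s (S (coeff γ q)) : ℂ) / Polynomial.aeval s (S b) *
        J (monomial γ 1) (s + (1:ℤ)) +
      ∑ i, ∑ γ ∈ (h i).support, (Polynomial.aeval s (S (coeff γ (h i))) : ℂ) /
        Polynomial.aeval s (S b) * B i (monomial γ 1) (s + ((-(m + L) : ℤ) : ℂ)), ?_, ?_⟩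
  · refine OK.add (OK.sum _ fun γ _ => OK.ratfun_mul ((hJ _).shift 1) _ _ (comp_ne hb _))
      (OK.sum _ fun i _ => OK.sum _ fun γ _ => OK.ratfun_mul ?_ _ _ (comp_ne hb _))
    exact ((hB1 i (monomial γ 1) (M + 1 + (m + L))).shift (-(m + L))).mono (by lia)
  · have hJ2 : ∀ᶠ s in farR, ∀ γ ∈ q.support,
        J (monomial γ 1) (s + 1) = Zc F (monomial γ 1) (s + 1) := by
      rw [Filter.eventually_all_finset]
      intro γ _
      exact (farR_shift 1).eventually (hJ' (monomial γ 1))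
    filter_upwards [hJ2, farR_gt (m + L + 1), farR_poly _ (comp_ne hb m)] with s h1 h2 h3
    have hk := step_integral hF key (w := s - m) (by simp; linarith)
    rw [aeval_comp_sub] at h3
    simp only [hS, aeval_comp_sub]
    rw [sub_add_cancel] at hk
    rw [← mul_right_inj' h3, hk, mul_add, Finset.mul_sum, Finset.mul_sum]
    congr 1
    · refine Finset.sum_congr rfl fun γ hγ => ?_
      rw [Int.cast_one, h1 γ hγ]
      field_simp
    · refine Finset.sum_congr rfl fun i _ => ?_
      rw [Finset.mul_sum]
      refine Finset.sum_congr rfl fun γ hγ => ?_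
      have e : s + ((-(m + L) : ℤ) : ℂ) = s - m - L := by push_cast; ring
      rw [e, hB2 i _ _ (by simp; linarith)]
      field_simp

lemma cont_all {n : ℕ} {F : MvPolynomial (Fin n) ℚ} (hF : CubeNonneg F) (hF0 : F ≠ 0) (hB : HB F)
    (M : ℕ) : ∀ G, ∃ I, OK M I ∧ ∀ᶠ s in farR, I s = Zc F G s := by
  induction M with
  | zero =>
    intro G
    refine ⟨Zc F G, ⟨fun s hs => (Zc_analyticAt hF G (by simpa using hs)).meromorphicAt,
      fun s hs => (Zc_good hF G (by simpa using hs)).nice⟩, Eventually.of_forall fun s => rfl⟩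
  | succ k ih =>
    intro G
    have := cont_step hF hF0 hB k ih G
    exact_mod_cast this

lemma agree {c : ℝ} {I J : ℂ → ℂ} (hI : ∀ s : ℂ, c < s.re → MeromorphicAt I s)
    (hJ : ∀ s : ℂ, c < s.re → MeromorphicAt J s) (h : ∀ᶠ s in farR, I s = J s)
    {s : ℂ} (hs : c < s.re) : ∀ᶠ z in 𝓝[≠] s, I z = J z := by
  have hD : MeromorphicOn (fun z => I z - J z) {z : ℂ | c < z.re} :=
    fun z hz => (hI z hz).sub (hJ z hz)
  have hpre : IsPreconnected {z : ℂ | c < z.re} := (convex_halfSpace_re_gt c).isPreconnected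
  have htop : meromorphicOrderAt (fun z => I z - J z) s = ⊤ := by
    by_contra hne
    rw [Filter.eventually_comap, Filter.eventually_atTop] at h
    obtain ⟨a, ha⟩ := h
    set y : ℂ := ((max a c + 1 : ℝ) : ℂ) with hy
    have hyc : c < y.re := by
      rw [hy, ofReal_re]; linarith [le_max_right a c]
    have hya : a < y.re := by
      rw [hy, ofReal_re]; linarith [le_max_left a c]
    refine hD.meromorphicOrderAt_ne_top_of_isPreconnected hpre hs hyc hne ?_
    rw [meromorphicOrderAt_eq_top_iff]
    have : ∀ᶠ z in 𝓝 y, a < z.re := continuous_re.continuousAt.eventually_const_lt hya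
    filter_upwards [this.filter_mono nhdsWithin_le_nhds] with z hz
    rw [ha _ hz.le z rfl, sub_self]
  rw [meromorphicOrderAt_eq_top_iff] at htop
  filter_upwards [htop] with z hz using sub_eq_zero.1 hz

lemma glue {n : ℕ} {F : MvPolynomial (Fin n) ℚ} (hF : CubeNonneg F) (G : MvPolynomial (Fin n) ℚ)
    (h : ∀ M : ℕ, ∃ I, OK M I ∧ ∀ᶠ s in farR, I s = Zc F G s) :
    ∃ I, (∀ M, OK M I) ∧ ∀ s : ℂ, 0 < s.re → I s = Zc F G s := by
  choose J hJ hJ' using h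
  classical
  set N : ℂ → ℕ := fun s => ⌊-s.re⌋₊ + 2 with hN
  set I : ℂ → ℂ := fun s => if 0 < s.re then Zc F G s else J (N s) s with hIdef
  have main : ∀ s₀ : ℂ, ∃ K : ℕ, -(K:ℝ) < s₀.re ∧ ∀ᶠ s in 𝓝[≠] s₀, J K s = I s := by
    intro s₀
    set K : ℕ := ⌊-s₀.re + 1⌋₊ + 2 with hK
    have hK0 : -(K:ℝ) < s₀.re := by
      have := Nat.lt_floor_add_one (-s₀.re + 1)
      rw [hK]; push_cast; linarith
    refine ⟨K, hK0, ?_⟩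
    have h1 : ∀ᶠ s in 𝓝[≠] s₀, ∀ j ∈ Finset.range (K + 1), -(j:ℝ) < s₀.re → J K s = J j s := by
      rw [Filter.eventually_all_finset]
      intro j hj
      have hj' : j ≤ K := by simpa [Nat.lt_succ_iff] using hj
      have hjr : (j:ℝ) ≤ K := by exact_mod_cast hj'
      by_cases hjs : -(j:ℝ) < s₀.re
      · have := agree (c := -(j:ℝ)) (I := J K) (J := J j)
          (fun s hs => (hJ K).1 s (by simp; linarith)) (fun s hs => (hJ j).1 s (by simpa using hs))
          (by filter_upwards [hJ' K, hJ' j] with s a b; rw [a, b]) hjs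
        filter_upwards [this] with s hs _ using hs
      · exact Eventually.of_forall fun s hh => absurd hh hjs
    have h2 : ∀ᶠ s in 𝓝[≠] s₀, AnalyticAt ℂ (J K) s :=
      ((hJ K).1 s₀ (by simpa using hK0)).eventually_analyticAt
    have h3 : ∀ᶠ s in 𝓝[≠] s₀, s₀.re - 1/2 < s.re :=
      (continuous_re.continuousAt.eventually_const_lt (by linarith)).filter_mono nhdsWithin_le_nhds
    have h4 : ∀ᶠ s in 𝓝[≠] s₀, s.re < s₀.re + 1/2 :=
      (continuous_re.continuousAt.eventually_lt_const (by linarith)).filter_mono nhdsWithin_le_nhds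
    filter_upwards [h1, h2, h3, h4] with s h1 h2 h3 h4
    rw [hIdef]
    dsimp only
    split_ifs with hs
    · have hz := Zc_analyticAt hF G hs
      have hag := agree (c := 0) (I := J K) (J := Zc F G)
        (fun s hs => (hJ K).1 s (by
          have : (0:ℝ) ≤ K := Nat.cast_nonneg K
          simp; linarith)) (fun s hs => (Zc_analyticAt hF G hs).meromorphicAt) (hJ' K) hs
      exact tendsto_nhds_unique_of_eventuallyEq
        (h2.continuousAt.tendsto.mono_left nhdsWithin_le_nhds)
        (hz.continuousAt.tendsto.mono_left nhdsWithin_le_nhds) hag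
    · refine h1 (N s) ?_ ?_
      · rw [Finset.mem_range, Nat.lt_succ_iff, hN, hK]
        have : ⌊-s.re⌋₊ ≤ ⌊-s₀.re + 1⌋₊ := Nat.floor_le_floor (by linarith)
        lia
      · have := Nat.lt_floor_add_one (-s.re)
        rw [hN]; push_cast; linarith
  refine ⟨I, fun M => ⟨fun s _ => ?_, fun s₀ _ => ?_⟩, fun s hs => by rw [hIdef]; simp [hs]⟩
  · obtain ⟨K, hK, h⟩ := main s
    exact ((hJ K).1 s (by simpa using hK)).congr h
  · obtain ⟨K, hK, h⟩ := main s₀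
    refine ((hJ K).2 s₀ ?_).congr h
    simp only [intCast_re] at hK
    exact_mod_cast hK

lemma cube_ext (n : ℕ) : ∀ (F G : MvPolynomial (Fin n) ℚ), CubeNonneg F →
    ∃ I, (∀ M, OK M I) ∧ ∀ s : ℂ, 0 < s.re → I s = Zc F G s := by
  have zero : ∀ {n : ℕ} (G : MvPolynomial (Fin n) ℚ),
      ∃ I, (∀ M, OK M I) ∧ ∀ s : ℂ, 0 < s.re → I s = Zc 0 G s := by
    intro n G
    refine ⟨fun _ => 0, fun M => ⟨fun s _ => MeromorphicAt.const 0 s, fun s _ => nice_zero s⟩, ?_⟩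
    intro s hs
    have : s ≠ 0 := by rintro rfl; simp at hs
    simp [Zc, ev, zero_cpow this]
  induction n with
  | zero =>
    intro F G hF
    by_cases hF0 : F = 0
    · rw [hF0]; exact zero G
    · exact glue hF G fun M => cont_all hF hF0 (fun i => i.elim0) M G
  | succ n ih =>
    intro F G hF
    by_cases hF0 : F = 0
    · rw [hF0]; exact zero G
    · refine glue hF G fun M => cont_all hF hF0 (fun i h => ?_) M G
      obtain ⟨I1, h1, h1'⟩ := ih (face i 1 F) (face i 1 h) (face_nonneg i (by simp) hF)
      obtain ⟨I0, h0, h0'⟩ := ih (face i 0 F) (face i 0 h) (face_nonneg i (by simp) hF)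
      refine ⟨_, fun M => (h1 M).add ((h0 M).ratfun_mul (Polynomial.C (-1)) 1 one_ne_zero), ?_⟩
      intro s hs
      rw [bdI_integral i hF h hs, h1' s (by linarith), h0' s (by linarith)]
      simp [sub_eq_add_neg]

end Cont


section Simplex
open MvPolynomial Set Filter Topology
open scoped Pointwise

def smp (n : ℕ) : Set (Fin n → ℝ) := {x | (∀ i, 0 ≤ x i) ∧ ∑ i, x i ≤ 1}

lemma smp_compact (n : ℕ) : IsCompact (smp n) := by
  refine (cube_compact n).of_isClosed_subset ?_ ?_
  · have h1 : IsClosed {x : Fin n → ℝ | ∀ i, 0 ≤ x i} := by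
      simp only [setOf_forall]
      exact isClosed_iInter fun i => isClosed_le continuous_const (continuous_apply i)
    have h2 : IsClosed {x : Fin n → ℝ | ∑ i, x i ≤ 1} :=
      isClosed_le (continuous_finsetSum _ fun i _ => continuous_apply i) continuous_const
    exact h1.inter h2
  · rintro x ⟨h1, h2⟩ i
    exact ⟨h1 i, (Finset.single_le_sum (fun j _ => h1 j) (Finset.mem_univ i)).trans h2⟩

lemma cons_mem_smp {n : ℕ} {t : ℝ} {y : Fin n → ℝ} :
    Fin.cons (α := fun _ => ℝ) t y ∈ smp (n + 1) ↔ 0 ≤ t ∧ (∀ i, 0 ≤ y i) ∧ t + ∑ i, y i ≤ 1 := by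
  simp only [smp, mem_setOf_eq, Fin.forall_fin_succ, Fin.cons_zero, Fin.cons_succ,
    Fin.sum_univ_succ, and_assoc]

lemma smp_slice {n : ℕ} {t : ℝ} (h0 : 0 ≤ t) (h1 : t < 1) :
    {y : Fin n → ℝ | Fin.cons (α := fun _ => ℝ) t y ∈ smp (n + 1)} = (1 - t) • smp n := by
  have hr : 0 < 1 - t := by linarith
  ext y
  rw [Set.mem_smul_set_iff_inv_smul_mem₀ hr.ne', mem_setOf_eq, cons_mem_smp]
  simp only [smp, mem_setOf_eq, Pi.smul_apply, smul_eq_mul, ← Finset.mul_sum]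
  have e1 : ∀ a : ℝ, 0 ≤ (1 - t)⁻¹ * a ↔ 0 ≤ a := fun a => mul_nonneg_iff_of_pos_left (inv_pos.2 hr)
  have e2 : (1 - t)⁻¹ * ∑ i, y i ≤ 1 ↔ t + ∑ i, y i ≤ 1 := by
    rw [inv_mul_le_iff₀ hr]; constructor <;> intro h <;> linarith
  simp only [e1, e2, h0, true_and]

lemma cons_cont {n : ℕ} (t : ℝ) : Continuous fun y : Fin n → ℝ => Fin.cons (α := fun _ => ℝ) t y := by
  refine continuous_pi fun j => ?_
  refine Fin.cases ?_ (fun k => ?_) j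
  · simpa using continuous_const
  · simpa using continuous_apply k

lemma aeval_cons_rename {n : ℕ} (t : ℝ) (y : Fin n → ℝ) (p : MvPolynomial (Fin n) ℚ) :
    (aeval (Fin.cons (α := fun _ => ℝ) t y) (rename Fin.succ p) : ℝ) = aeval y p := by
  rw [aeval_rename]
  congr 2

lemma simplex_cube (n : ℕ) : ∃ (T : Fin n → MvPolynomial (Fin n) ℚ) (J : MvPolynomial (Fin n) ℚ),
    (∀ u : Fin n → ℝ, (∀ i, u i ∈ Icc (0:ℝ) 1) → (fun i => (aeval u (T i) : ℝ)) ∈ smp n) ∧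
    ∀ φ : (Fin n → ℝ) → ℂ, ContinuousOn φ (smp n) →
      ∫ x in smp n, φ x = ∫ u, ev u J * φ (fun i => (aeval u (T i) : ℝ)) ∂(cubeM (Fin n)) := by
  induction n with
  | zero =>
    refine ⟨fun i => i.elim0, 1, fun u _ => by simp [smp], fun φ _ => ?_⟩
    rw [cubeM_eq]
    have : smp 0 = Set.univ.pi fun _ => Ioo 0 1 := by ext x; simp [smp]
    rw [this]
    refine integral_congr_ae (Eventually.of_forall fun x => ?_)
    have e : x = (fun i => (aeval x ((fun i => i.elim0 : Fin 0 → MvPolynomial (Fin 0) ℚ) i) : ℝ)) :=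
      Subsingleton.elim _ _
    simp only [ev, map_one, ofReal_one, one_mul]
    exact congrArg φ e
  | succ n ih =>
    obtain ⟨T, J, hT, hJ⟩ := ih
    set T' : Fin (n + 1) → MvPolynomial (Fin (n + 1)) ℚ :=
      Fin.cons (α := fun _ => MvPolynomial (Fin (n + 1)) ℚ) (X 0)
        (fun i => (1 - X 0) * rename Fin.succ (T i)) with hT'
    set J' : MvPolynomial (Fin (n + 1)) ℚ := (1 - X 0) ^ n * rename Fin.succ J with hJ'
    have eT : ∀ (t : ℝ) (u : Fin n → ℝ),
        (fun i => (aeval (Fin.cons (α := fun _ => ℝ) t u) (T' i) : ℝ)) =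
          Fin.cons (α := fun _ => ℝ) t ((1 - t) • fun i => (aeval u (T i) : ℝ)) := by
      intro t u
      ext i
      refine Fin.cases ?_ (fun k => ?_) i
      · simp [hT']
      · simp [hT', aeval_cons_rename]
    have eJ : ∀ (t : ℝ) (u : Fin n → ℝ),
        ev (Fin.cons (α := fun _ => ℝ) t u) J' = ((1 - t) ^ n : ℝ) * ev u J := by
      intro t u
      simp [hJ', ev, aeval_cons_rename]
    have hT2 : ∀ u : Fin (n + 1) → ℝ, (∀ i, u i ∈ Icc (0:ℝ) 1) →
        (fun i => (aeval u (T' i) : ℝ)) ∈ smp (n + 1) := by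
      intro u hu
      obtain ⟨t, y, rfl⟩ : ∃ (t : ℝ) (y : Fin n → ℝ), u = Fin.cons (α := fun _ => ℝ) t y :=
        ⟨u 0, Fin.tail u, (Fin.cons_self_tail u).symm⟩
      have ht : t ∈ Icc (0:ℝ) 1 := by simpa using hu 0
      have hy := hT y (fun i => by simpa using hu i.succ)
      rw [eT, cons_mem_smp]
      have hr : 0 ≤ 1 - t := by linarith [ht.2]
      refine ⟨ht.1, fun i => mul_nonneg hr (hy.1 i), ?_⟩
      simp only [Pi.smul_apply, smul_eq_mul, ← Finset.mul_sum]
      have := mul_le_mul_of_nonneg_left hy.2 hr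
      linarith
    refine ⟨T', J', hT2, fun φ hφ => ?_⟩
    have hm : MeasurableSet (smp (n + 1)) := (smp_compact _).measurableSet
    have hint : Integrable ((smp (n + 1)).indicator φ) volume :=
      (integrable_indicator_iff hm).2 (hφ.integrableOn_compact (smp_compact _))
    have hmp : MeasurePreserving (MeasurableEquiv.piFinSuccAbove (fun _ : Fin (n+1) => ℝ) 0).symm
        ((volume : Measure ℝ).prod (volume : Measure (Fin n → ℝ))) (volume : Measure (Fin (n+1) → ℝ)) :=
      (volume_preserving_piFinSuccAbove (fun _ : Fin (n+1) => ℝ) 0).symm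
    have hmpc : MeasurePreserving (MeasurableEquiv.piFinSuccAbove (fun _ : Fin (n+1) => ℝ) 0).symm
        (((volume : Measure ℝ).restrict (Ioo 0 1)).prod (cubeM (Fin n))) (cubeM (Fin (n+1))) :=
      (measurePreserving_piFinSuccAbove (fun _ => (volume : Measure ℝ).restrict (Ioo 0 1)) 0).symm
    have e0 : ∀ z : ℝ × (Fin n → ℝ), (MeasurableEquiv.piFinSuccAbove (fun _ : Fin (n+1) => ℝ) 0).symm z
        = Fin.cons (α := fun _ => ℝ) z.1 z.2 := by
      intro z
      rw [← Fin.insertNth_zero']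
      rfl
    have hc : Integrable (fun u => ev u J' * φ (fun i => (aeval u (T' i) : ℝ))) (cubeM (Fin (n+1))) := by
      refine integrable_of_contOn (ContinuousOn.mul
        (continuous_ofReal.comp (aeval_cont J')).continuousOn ?_)
      refine ContinuousOn.comp (g := φ) (f := fun u => fun i => (aeval u (T' i) : ℝ)) hφ
        (continuous_pi fun i => aeval_cont (T' i)).continuousOn ?_
      exact fun u hu => hT2 u hu
    have i1 := hmp.integrable_comp_of_integrable hint
    have i2 := hmpc.integrable_comp_of_integrable hc
    rw [← integral_indicator hm, ← hmp.integral_comp (MeasurableEquiv.measurableEmbedding _),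
      ← hmpc.integral_comp (MeasurableEquiv.measurableEmbedding _)]
    simp only [Function.comp_def, e0] at i1 i2 ⊢
    rw [integral_prod _ i1, integral_prod _ i2, ← integral_indicator measurableSet_Ioo]
    refine integral_congr_ae ?_
    have hne : ∀ᵐ t : ℝ ∂volume, t ≠ 0 ∧ t ≠ 1 := by
      have a0 : ∀ᵐ t : ℝ ∂volume, t ≠ 0 := by simp [ae_iff]
      have a1 : ∀ᵐ t : ℝ ∂volume, t ≠ 1 := by simp [ae_iff]
      filter_upwards [a0, a1] with t h0 h1 using ⟨h0, h1⟩
    filter_upwards [hne] with t ht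
    have hms : MeasurableSet {y : Fin n → ℝ | Fin.cons (α := fun _ => ℝ) t y ∈ smp (n + 1)} :=
      (cons_cont t).measurable hm
    have hin : ∫ y : Fin n → ℝ, (smp (n + 1)).indicator φ (Fin.cons (α := fun _ => ℝ) t y) =
        ∫ y in {y : Fin n → ℝ | Fin.cons (α := fun _ => ℝ) t y ∈ smp (n + 1)},
          φ (Fin.cons (α := fun _ => ℝ) t y) := by
      rw [← integral_indicator hms]
      rfl
    rw [hin]
    by_cases hti : t ∈ Ioo (0:ℝ) 1
    · rw [indicator_of_mem hti, smp_slice hti.1.le hti.2]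
      have hr : 0 < 1 - t := by linarith [hti.2]
      have hsc := Measure.setIntegral_comp_smul_of_pos (volume : Measure (Fin n → ℝ))
        (fun y => φ (Fin.cons (α := fun _ => ℝ) t y)) (smp n) hr
      have hco : ContinuousOn (fun y : Fin n → ℝ => φ (Fin.cons (α := fun _ => ℝ) t ((1 - t) • y)))
          (smp n) := by
        refine ContinuousOn.comp (g := φ) (f := fun y : Fin n → ℝ =>
          Fin.cons (α := fun _ => ℝ) t ((1 - t) • y)) hφ
          ((cons_cont t).comp (continuous_const_smul (1 - t))).continuousOn ?_
        intro y hy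
        have : (1 - t) • y ∈ {y : Fin n → ℝ | Fin.cons (α := fun _ => ℝ) t y ∈ smp (n + 1)} := by
          rw [smp_slice hti.1.le hti.2]
          exact Set.smul_mem_smul_set hy
        exact this
      rw [hJ _ hco] at hsc
      simp only [eT, eJ, mul_assoc]
      rw [integral_const_mul, hsc, Module.finrank_fin_fun, Complex.real_smul, ← mul_assoc,
        ← ofReal_mul, mul_inv_cancel₀ (pow_pos hr n).ne', ofReal_one, one_mul]
    · rw [indicator_of_notMem hti]
      have : {y : Fin n → ℝ | Fin.cons (α := fun _ => ℝ) t y ∈ smp (n + 1)} = ∅ := by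
        rw [Set.eq_empty_iff_forall_notMem]
        intro y hy
        rw [mem_setOf_eq, cons_mem_smp] at hy
        have h3 : 0 ≤ ∑ i, y i := Finset.sum_nonneg fun i _ => hy.2.1 i
        exact hti ⟨lt_of_le_of_ne hy.1 (Ne.symm ht.1),
          lt_of_le_of_ne (by linarith [hy.2.2]) ht.2⟩
      rw [this]; simp

end Simplex


/-- Let `f ∈ ℚ[x_1,…,x_n]` be non-negative and not identically zero on the standard simplex
`Δ`. Then `I(s) = ∫_Δ f^s dμ` (defined for `Re s > 0`) extends to a meromorphic function on
`ℂ`, and all the coefficients of the Laurent expansion of `I` at any integer `s₀` are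
periods. -/
theorem igusa_zeta_laurent_coefficients_are_periods
    (n : ℕ) (f : MvPolynomial (Fin n) ℚ)
    (Δ : Set (Fin n → ℝ))
    (hΔ : Δ = {x : Fin n → ℝ | (∀ i, 0 ≤ x i) ∧ ∑ i, x i ≤ 1})
    (hnonneg : ∀ x ∈ Δ, 0 ≤ MvPolynomial.aeval x f)
    (hnz : ∃ x ∈ Δ, MvPolynomial.aeval x f ≠ 0) :
    ∃ I : ℂ → ℂ,
      MeromorphicOn I Set.univ ∧
      (∀ s : ℂ, 0 < s.re →
        IntegrableOn (fun x => ((MvPolynomial.aeval x f : ℝ) : ℂ) ^ s) Δ volume ∧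
        I s = ∫ x in Δ, ((MvPolynomial.aeval x f : ℝ) : ℂ) ^ s) ∧
      (∀ s₀ : ℤ, ∃ (N : ℤ) (a : ℕ → ℂ),
        (∀ i, IsPeriod (a i)) ∧
        ∀ᶠ s in nhdsWithin (s₀ : ℂ) {(s₀ : ℂ)}ᶜ,
          I s = ∑' i : ℕ, a i * (s - (s₀ : ℂ)) ^ (N + i)) := by
  have hΔ' : Δ = smp n := hΔ
  subst hΔ'
  clear hΔ
  obtain ⟨T, J, hT, hJ⟩ := simplex_cube n
  have eF : ∀ u : Fin n → ℝ, (MvPolynomial.aeval u (MvPolynomial.bind₁ T f) : ℝ) =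
      MvPolynomial.aeval (fun i => (MvPolynomial.aeval u (T i) : ℝ)) f := fun u =>
    MvPolynomial.aeval_bind₁ _ _ _
  have hF : CubeNonneg (MvPolynomial.bind₁ T f) := fun u hu => by
    rw [eF]; exact hnonneg _ (hT u hu)
  obtain ⟨I, hI, hI'⟩ := cube_ext n _ J hF
  refine ⟨I, fun s _ => ?_, fun s hs => ?_, fun s₀ => ?_⟩
  · refine (hI (⌊-s.re⌋₊ + 1 : ℕ)).1 s ?_
    have := Nat.lt_floor_add_one (-s.re)
    push_cast
    linarith
  · have hc : ContinuousOn (fun x => ((MvPolynomial.aeval x f : ℝ) : ℂ) ^ s) (smp n) :=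
      fun x hx => (cpow_cont (F := f) (hnonneg x hx) hs).continuousWithinAt
    refine ⟨hc.integrableOn_compact (smp_compact n), ?_⟩
    rw [hI' s hs, hJ _ hc, Zc]
    simp only [← eF]
    rfl
  · exact Nice.laurent ((hI (-s₀ + 1)).2 s₀ (by lia))
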